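/- For all 1 ≤ a, b ≤ m, every R-module homomorphism M_a → M_b is an S-linear combination of restrictions to M_a of composites of the operators ∂_{λ_1},…,∂_{λ_m} and θ_{g_1},…,θ_{g_n}; equivalently, the S-linear map from the degree-(b−a) homogeneous component of Cliff_S(q_φ) (for the ℤ-grading with deg λ_i = −1, deg g_j = +1) to Hom_R(M_a, M_b), given by restricting the Clifford action to M_a, is surjective. -/

import Mathlib

/-!
STATEMENT 4: With `K` a field, `m ≤ n` positive integers, `S = K[x_{ij}]`, `φ : S^n → S^m` the
generic map, `R = S/I_m(X)` and `M_a = coker(Λ^a φ)`: for all `1 ≤ a, b ≤ m`, every `R`-module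
homomorphism `M_a → M_b` is an `S`-linear combination of (restrictions to `M_a` of) composites
of the contraction operators `∂_λ : M_{c+1} → M_c` (`λ ∈ (S^m)^∨`) and the exterior
multiplication operators `θ_g : M_c → M_{c+1}` (`g ∈ S^n`).

Since `S → R` is surjective and `M_a`, `M_b` are `R`-modules, `Hom_R(M_a,M_b) = Hom_S(M_a,M_b)`.
The operators `∂_λ` and `θ_g` are the (unique) operators between the graded cokernels induced,
along the quotient maps, by left contraction with `λ` resp. exterior left multiplication by
`φ(g)` on the exterior algebra `Λ S^m`; the theorem is stated for any family of operators
satisfying these induction (commuting-square) conditions.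
-/

noncomputable section

/-- `S = K[x_{ij}]`. -/
abbrev detS (K : Type) [Field K] (m n : ℕ) : Type := MvPolynomial (Fin m × Fin n) K

/-- The generic matrix `X`. -/
def genX (K : Type) [Field K] (m n : ℕ) : Matrix (Fin m) (Fin n) (detS K m n) :=
  fun i j => MvPolynomial.X (i, j)

/-- The generic map `φ : S^n → S^m`. -/
def genφ (K : Type) [Field K] (m n : ℕ) :
    (Fin n → detS K m n) →ₗ[detS K m n] (Fin m → detS K m n) :=
  Matrix.toLin' (genX K m n)

/-- `M_a = coker(Λ^a φ : ⋀^a S^n → ⋀^a S^m)`, the quotient of the `a`-th exterior power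
(taken as a submodule of the exterior algebra) by the image of `⋀^a S^n` under `Λ φ`. -/
abbrev detMa (K : Type) [Field K] (m n a : ℕ) : Type :=
  (⋀[detS K m n]^a (Fin m → detS K m n)) ⧸
    (Submodule.comap (⋀[detS K m n]^a (Fin m → detS K m n)).subtype
      (Submodule.map (ExteriorAlgebra.map (genφ K m n)).toLinearMap
        (⋀[detS K m n]^a (Fin n → detS K m n))))

/-- The quotient map `⋀^a S^m → M_a`. -/
def detπa (K : Type) [Field K] (m n a : ℕ) :
    (⋀[detS K m n]^a (Fin m → detS K m n)) →ₗ[detS K m n] detMa K m n a :=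
  Submodule.mkQ _

/-- Left contraction with `λ ∈ (S^m)^∨` on the exterior algebra `Λ S^m`. -/
def ctr (K : Type) [Field K] (m n : ℕ)
    (lam : Module.Dual (detS K m n) (Fin m → detS K m n)) :
    ExteriorAlgebra (detS K m n) (Fin m → detS K m n) →ₗ[detS K m n]
      ExteriorAlgebra (detS K m n) (Fin m → detS K m n) :=
  CliffordAlgebra.contractLeft (Q := (0 : QuadraticForm (detS K m n) (Fin m → detS K m n))) lam

/-- Words in the operators `∂_λ` and `θ_g`: the composites `M_a → M_b` of operators from the
families `D` (the `∂_λ`) and `T` (the `θ_g`), starting with the identity of `M_a`. -/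
inductive IsWord (K : Type) [Field K] (m n : ℕ)
    (D : Module.Dual (detS K m n) (Fin m → detS K m n) →
      ∀ c : ℕ, detMa K m n (c + 1) →ₗ[detS K m n] detMa K m n c)
    (T : (Fin n → detS K m n) →
      ∀ c : ℕ, detMa K m n c →ₗ[detS K m n] detMa K m n (c + 1)) :
    ∀ a b : ℕ, (detMa K m n a →ₗ[detS K m n] detMa K m n b) → Prop
  | id (a : ℕ) : IsWord K m n D T a a LinearMap.id
  | down {a c : ℕ} (lam) (w) (hw : IsWord K m n D T a (c + 1) w) :
      IsWord K m n D T a c ((D lam c).comp w)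
  | up {a c : ℕ} (g) (w) (hw : IsWord K m n D T a c w) :
      IsWord K m n D T a (c + 1) ((T g c).comp w)

/-! ### The linear forms of the generic matrix -/

namespace GenericMatrix

open MvPolynomial

set_option linter.unusedSectionVars false

variable (K : Type) [Field K] {σ τ : Type} [DecidableEq σ] [DecidableEq τ]

/-- Polynomials in auxiliary variables `y_i` over the coordinate ring of generic matrices. -/
abbrev BiPoly (σ τ : Type) : Type := MvPolynomial σ (MvPolynomial (σ × τ) K)

/-- The linear form `∑_{i ∈ T} y_i x_{ij}`. -/
def lin (T : Finset σ) (j : τ) : BiPoly K σ τ := ∑ i ∈ T, X i * C (X (i, j))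

/-- The ideal generated by the forms `lin T j` with `j ∈ J`. -/
def linIdeal (T : Finset σ) (J : Finset τ) : Ideal (BiPoly K σ τ) :=
  Ideal.span (Set.image (lin K T) J)

/-- The ideal generated by the variables `y_i` with `i ∈ T`. -/
def varIdeal (τ : Type) (T : Finset σ) : Ideal (BiPoly K σ τ) :=
  Ideal.span (Set.image X (T : Set σ))

/-- The substitution `y_i = 0` for `i ∈ T`. -/
def evZero (τ : Type) (T : Finset σ) :
    BiPoly K σ τ →ₐ[MvPolynomial (σ × τ) K] BiPoly K σ τ :=
  aeval fun i => if i ∈ T then 0 else X i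

variable {K}

lemma mem_linIdeal_iff {T : Finset σ} {J : Finset τ} {f : BiPoly K σ τ} :
    f ∈ linIdeal K T J ↔ ∃ q : τ → BiPoly K σ τ, f = ∑ j ∈ J, lin K T j * q j := by
  constructor
  · intro h
    induction h using Submodule.span_induction with
    | mem x hx =>
      obtain ⟨j, hj, rfl⟩ := hx
      exact ⟨Pi.single j 1, by simp [Pi.single_apply, show j ∈ J from hj]⟩
    | zero => exact ⟨0, by simp⟩
    | add x y _ _ hx hy =>
      obtain ⟨q, rfl⟩ := hx
      obtain ⟨r, rfl⟩ := hy
      exact ⟨q + r, by simp only [Pi.add_apply, mul_add, Finset.sum_add_distrib]⟩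
    | smul a x _ hx =>
      obtain ⟨q, rfl⟩ := hx
      refine ⟨fun j => a * q j, ?_⟩
      rw [smul_eq_mul, Finset.mul_sum]
      exact Finset.sum_congr rfl fun j _ => by ring
  · rintro ⟨q, rfl⟩
    exact Ideal.sum_mem _ fun j hj =>
      Ideal.mul_mem_right _ _ (Ideal.subset_span ⟨j, hj, rfl⟩)

lemma lin_mem_linIdeal {T : Finset σ} {J : Finset τ} {j : τ} (hj : j ∈ J) :
    lin K T j ∈ linIdeal K T J :=
  Ideal.subset_span ⟨j, hj, rfl⟩

lemma linIdeal_mono (T : Finset σ) {J J' : Finset τ} (h : J ⊆ J') :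
    linIdeal K T J ≤ linIdeal K T J' :=
  Ideal.span_mono (Set.image_mono (by exact_mod_cast h))

lemma X_mem_varIdeal {T : Finset σ} {i : σ} (hi : i ∈ T) :
    (X i : BiPoly K σ τ) ∈ varIdeal K τ T :=
  Ideal.subset_span ⟨i, hi, rfl⟩

lemma lin_mem_varIdeal (T : Finset σ) (j : τ) : lin K T j ∈ varIdeal K τ T :=
  Ideal.sum_mem _ fun _ hi => Ideal.mul_mem_right _ _ (X_mem_varIdeal hi)

lemma sub_evZero_mem (T : Finset σ) (f : BiPoly K σ τ) :
    f - evZero K τ T f ∈ varIdeal K τ T := by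
  rw [← Ideal.Quotient.mk_eq_mk_iff_sub_mem]
  have : (Ideal.Quotient.mkₐ (MvPolynomial (σ × τ) K) (varIdeal K τ T)) =
      (Ideal.Quotient.mkₐ (MvPolynomial (σ × τ) K) (varIdeal K τ T)).comp (evZero K τ T) := by
    apply MvPolynomial.algHom_ext
    intro i
    simp only [evZero, AlgHom.comp_apply, aeval_X, Ideal.Quotient.mkₐ_eq_mk]
    split_ifs with h
    · rw [map_zero, Ideal.Quotient.eq_zero_iff_mem]
      exact X_mem_varIdeal h
    · rfl
  exact DFunLike.congr_fun this f

lemma evZero_eq_zero {T : Finset σ} {f : BiPoly K σ τ} (hf : f ∈ varIdeal K τ T) :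
    evZero K τ T f = 0 := by
  have : varIdeal K τ T ≤ RingHom.ker (evZero K τ T) := by
    unfold varIdeal
    rw [Ideal.span_le]
    rintro _ ⟨i, hi, rfl⟩
    have hi' : i ∈ T := hi
    simp [evZero, hi']
  exact this hf

lemma evZero_evZero (T : Finset σ) (f : BiPoly K σ τ) :
    evZero K τ T (evZero K τ T f) = evZero K τ T f := by
  have := evZero_eq_zero (sub_evZero_mem T f)
  rw [map_sub, sub_eq_zero] at this
  exact this.symm

lemma pderiv_mem_varIdeal {T : Finset σ} (i : σ) {f : BiPoly K σ τ}
    (hf : f ∈ varIdeal K τ T ^ 2) : pderiv i f ∈ varIdeal K τ T := by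
  rw [pow_two] at hf
  induction hf using Submodule.mul_induction_on' with
  | mem_mul_mem a ha b hb =>
    rw [Derivation.leibniz]
    exact Ideal.add_mem _ (Ideal.mul_mem_right _ _ ha) (Ideal.mul_mem_right _ _ hb)
  | add a _ b _ ha hb =>
    rw [map_add]
    exact Ideal.add_mem _ ha hb

lemma sum_lin_mul_eq_of_mem {T : Finset σ} {J : Finset τ} {q : τ → BiPoly K σ τ}
    (h : ∑ j ∈ J, lin K T j * q j ∈ varIdeal K τ T ^ 2) :
    ∑ j ∈ J, lin K T j * q j = ∑ j ∈ J, lin K T j * (q j - evZero K τ T (q j)) := by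
  suffices h0 : ∑ j ∈ J, lin K T j * evZero K τ T (q j) = 0 by
    simp only [mul_sub, Finset.sum_sub_distrib, h0, sub_zero]
  have h1 : ∑ j ∈ J, lin K T j * evZero K τ T (q j) ∈ varIdeal K τ T ^ 2 := by
    have : ∑ j ∈ J, lin K T j * evZero K τ T (q j) = ∑ j ∈ J, lin K T j * q j -
        ∑ j ∈ J, lin K T j * (q j - evZero K τ T (q j)) := by
      simp only [mul_sub, Finset.sum_sub_distrib]; ring
    rw [this]
    refine Ideal.sub_mem _ h (Ideal.sum_mem _ fun j _ => ?_)
    rw [pow_two]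
    exact Ideal.mul_mem_mul (lin_mem_varIdeal T j) (sub_evZero_mem T _)
  set s : σ → BiPoly K σ τ := fun i => ∑ j ∈ J, C (X (i, j)) * evZero K τ T (q j) with hs
  have h2 : ∑ j ∈ J, lin K T j * evZero K τ T (q j) = ∑ i ∈ T, X i * s i := by
    simp only [hs, lin, Finset.sum_mul, Finset.mul_sum]
    rw [Finset.sum_comm]
    simp only [mul_assoc]
  have hes : ∀ i, evZero K τ T (s i) = s i := by
    intro i
    simp only [hs, map_sum, map_mul, evZero_evZero]
    refine Finset.sum_congr rfl fun j _ => ?_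
    congr 1
    exact (evZero K τ T).commutes _
  rw [h2]
  refine Finset.sum_eq_zero fun i hi => ?_
  have h3 := pderiv_mem_varIdeal i h1
  rw [h2, map_sum] at h3
  simp only [Derivation.leibniz, smul_eq_mul, Finset.sum_add_distrib] at h3
  rw [Ideal.add_mem_iff_right _
    (Ideal.sum_mem _ fun k hk => Ideal.mul_mem_right _ _ (X_mem_varIdeal hk))] at h3
  simp only [pderiv_X, Pi.single_apply, mul_ite, mul_one, mul_zero, Finset.sum_ite_eq',
    hi, if_true] at h3
  have := evZero_eq_zero h3
  rw [hes] at this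
  rw [this, mul_zero]

lemma evZero_singleton_lin {T : Finset σ} {p : σ} (hp : p ∉ T) (j : τ) :
    evZero K τ {p} (lin K (insert p T) j) = lin K T j := by
  unfold lin evZero
  rw [Finset.sum_insert hp, map_add, map_mul, aeval_X]
  simp only [Finset.mem_singleton, if_true, zero_mul, zero_add, map_sum, map_mul, aeval_X]
  refine Finset.sum_congr rfl fun i hi => ?_
  have hne : i ≠ p := fun h => hp (h ▸ hi)
  rw [if_neg hne]
  congr 1
  exact aeval_C _ _

lemma evZero_singleton_mem {T : Finset σ} {p : σ} {q : BiPoly K σ τ}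
    (hq : q ∈ varIdeal K τ (insert p T)) : evZero K τ {p} q ∈ varIdeal K τ T := by
  have : varIdeal K τ (insert p T) ≤ (varIdeal K τ T).comap (evZero K τ {p}) := by
    conv_lhs => unfold varIdeal
    rw [Ideal.span_le]
    rintro _ ⟨i, hi, rfl⟩
    simp only [SetLike.mem_coe, Ideal.mem_comap, evZero, aeval_X, Finset.mem_singleton]
    split_ifs with h
    · exact Ideal.zero_mem _
    · exact X_mem_varIdeal ((Finset.mem_insert.1 (by exact_mod_cast hi)).resolve_left h)
  exact this hq

lemma X_dvd_of_evZero {p : σ} {g : BiPoly K σ τ} (h : evZero K τ {p} g = 0) : X p ∣ g := by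
  have := sub_evZero_mem {p} g
  rw [h, sub_zero, varIdeal, Finset.coe_singleton, Set.image_singleton,
    Ideal.mem_span_singleton] at this
  exact this

/-- The forms `lin T c` are regular, in positive degree, modulo the forms of other columns. -/
def IsRegularForms (K : Type) [Field K] {σ : Type} (τ : Type) [DecidableEq σ]
    (T : Finset σ) : Prop :=
  ∀ (J : Finset τ) (c : τ), c ∉ J → ∀ q ∈ varIdeal K τ T,
    lin K T c * q ∈ linIdeal K T J → q ∈ linIdeal K T J

lemma mem_linIdeal_of_X_mul {T : Finset σ} (hT : IsRegularForms K τ T) {p : σ} (hp : p ∉ T)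
    (J : Finset τ) : ∀ (f : BiPoly K σ τ) (q : τ → BiPoly K σ τ),
      (∀ j, q j ∈ varIdeal K τ (insert p T)) →
      X p * f = ∑ j ∈ J, lin K (insert p T) j * q j → f ∈ linIdeal K (insert p T) J := by
  induction J using Finset.induction_on with
  | empty =>
    intro f q _ h
    rw [Finset.sum_empty, mul_eq_zero] at h
    rcases h with h | h
    · exact absurd h (X_ne_zero p)
    · rw [h]; exact Ideal.zero_mem _
  | insert c J hc ih =>
    intro f q hq h
    have h1 := congrArg (evZero K τ {p}) h
    rw [map_mul, evZero_eq_zero (X_mem_varIdeal (Finset.mem_singleton_self p)), zero_mul,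
      Finset.sum_insert hc, map_add, map_mul, map_sum, evZero_singleton_lin hp] at h1
    simp only [map_mul, evZero_singleton_lin hp] at h1
    have h2 : lin K T c * evZero K τ {p} (q c) ∈ linIdeal K T J := by
      rw [mem_linIdeal_iff]
      refine ⟨fun j => - evZero K τ {p} (q j), ?_⟩
      have h2 : ∑ j ∈ J, lin K T j * -evZero K τ {p} (q j) =
          -∑ j ∈ J, lin K T j * evZero K τ {p} (q j) := by
        rw [← Finset.sum_neg_distrib]
        exact Finset.sum_congr rfl fun j _ => by ring
      rw [h2]
      linear_combination -h1
    obtain ⟨r, hr⟩ := mem_linIdeal_iff.1 (hT J c hc _ (evZero_singleton_mem (hq c)) h2)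
    obtain ⟨s, hs⟩ : X p ∣ q c - ∑ j ∈ J, lin K (insert p T) j * r j := by
      apply X_dvd_of_evZero
      rw [map_sub, map_sum]
      simp only [map_mul, evZero_singleton_lin hp]
      have := congrArg (evZero K τ {p}) hr
      rw [evZero_evZero, map_sum] at this
      rw [this, ← Finset.sum_sub_distrib]
      refine Finset.sum_eq_zero fun j _ => ?_
      rw [map_mul, ← evZero_singleton_lin hp, evZero_evZero, sub_self]
    have h3 : f - lin K (insert p T) c * s ∈ linIdeal K (insert p T) J := by
      refine ih _ (fun j => q j + lin K (insert p T) c * r j) (fun j => ?_) ?_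
      · exact Ideal.add_mem _ (hq j) (Ideal.mul_mem_right _ _ (lin_mem_varIdeal _ _))
      · have e : ∑ j ∈ J, lin K (insert p T) j * (q j + lin K (insert p T) c * r j) =
            ∑ j ∈ J, lin K (insert p T) j * q j +
              lin K (insert p T) c * ∑ j ∈ J, lin K (insert p T) j * r j := by
          rw [Finset.mul_sum, ← Finset.sum_add_distrib]
          exact Finset.sum_congr rfl fun j _ => by ring
        rw [Finset.sum_insert hc] at h
        rw [e]
        linear_combination h + lin K (insert p T) c * hs
    have h4 := linIdeal_mono (K := K) (insert p T) (Finset.subset_insert c J) h3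
    have h5 := Ideal.mul_mem_right s _
      (lin_mem_linIdeal (K := K) (T := insert p T) (Finset.mem_insert_self c J))
    simpa using Ideal.add_mem _ h4 h5

/-- Solving the equations `lin (insert p T) j = 0`, `j ∈ J`, for the entries `x_{pj}`. -/
def elim (K : Type) [Field K] {σ τ : Type} [DecidableEq σ] [DecidableEq τ]
    (T : Finset σ) (p : σ) (J : Finset τ) :
    BiPoly K σ τ →+* FractionRing (BiPoly K σ τ) :=
  eval₂Hom
    (eval₂Hom (algebraMap K (FractionRing (BiPoly K σ τ))) fun ij =>
      if ij.1 = p ∧ ij.2 ∈ J then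
        - (algebraMap (BiPoly K σ τ) (FractionRing (BiPoly K σ τ)) (X p))⁻¹ *
          algebraMap (BiPoly K σ τ) (FractionRing (BiPoly K σ τ)) (lin K T ij.2)
      else algebraMap (BiPoly K σ τ) (FractionRing (BiPoly K σ τ)) (C (X ij)))
    fun i => algebraMap (BiPoly K σ τ) (FractionRing (BiPoly K σ τ)) (X i)

lemma elim_X (T : Finset σ) (p : σ) (J : Finset τ) (i : σ) :
    elim K T p J (X i) = algebraMap _ _ (X i : BiPoly K σ τ) := by
  simp [elim]

lemma elim_C_X (T : Finset σ) (p : σ) (J : Finset τ) (i : σ) (j : τ) :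
    elim K T p J (C (X (i, j))) = if i = p ∧ j ∈ J then
        - (algebraMap (BiPoly K σ τ) (FractionRing (BiPoly K σ τ)) (X p))⁻¹ *
          algebraMap (BiPoly K σ τ) (FractionRing (BiPoly K σ τ)) (lin K T j)
      else algebraMap (BiPoly K σ τ) (FractionRing (BiPoly K σ τ)) (C (X (i, j))) := by
  simp [elim]

lemma algebraMap_X_ne_zero (p : σ) :
    algebraMap (BiPoly K σ τ) (FractionRing (BiPoly K σ τ)) (X p) ≠ 0 := by
  rw [Ne, FaithfulSMul.algebraMap_eq_zero_iff]
  exact X_ne_zero p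

lemma elim_lin_of_notMem {T : Finset σ} {p : σ} (hp : p ∉ T) (J : Finset τ) (j : τ) :
    elim K T p J (lin K T j) = algebraMap _ _ (lin K T j) := by
  rw [lin, map_sum, map_sum]
  refine Finset.sum_congr rfl fun i hi => ?_
  have hne : ¬(i = p ∧ j ∈ J) := fun h => hp (h.1 ▸ hi)
  rw [map_mul, map_mul, elim_X, elim_C_X, if_neg hne]

lemma elim_lin {T : Finset σ} {p : σ} (hp : p ∉ T) {J : Finset τ} {j : τ} (hj : j ∈ J) :
    elim K T p J (lin K (insert p T) j) = 0 := by
  have : lin K (insert p T) j = X p * C (X (p, j)) + lin K T j := by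
    rw [lin, Finset.sum_insert hp, lin]
  rw [this, map_add, map_mul, elim_X, elim_C_X, elim_lin_of_notMem hp, if_pos ⟨rfl, hj⟩]
  have := algebraMap_X_ne_zero (K := K) (τ := τ) p
  field_simp
  ring

lemma elim_eq_zero_of_mem {T : Finset σ} {p : σ} (hp : p ∉ T) {J : Finset τ}
    {f : BiPoly K σ τ} (hf : f ∈ linIdeal K (insert p T) J) : elim K T p J f = 0 := by
  obtain ⟨q, rfl⟩ := mem_linIdeal_iff.1 hf
  rw [map_sum]
  refine Finset.sum_eq_zero fun j hj => ?_
  rw [map_mul, elim_lin hp hj, zero_mul]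

lemma exists_pow_mul_sub_mem {T : Finset σ} {p : σ} (hp : p ∉ T) (J : Finset τ)
    (f : BiPoly K σ τ) : ∃ (N : ℕ) (g : BiPoly K σ τ),
      X p ^ N * f - g ∈ linIdeal K (insert p T) J ∧ elim K T p J g = algebraMap _ _ g := by
  have hadd : ∀ f f' : BiPoly K σ τ, (∃ (N : ℕ) (g : BiPoly K σ τ),
      X p ^ N * f - g ∈ linIdeal K (insert p T) J ∧ elim K T p J g = algebraMap _ _ g) →
      (∃ (N : ℕ) (g : BiPoly K σ τ),
      X p ^ N * f' - g ∈ linIdeal K (insert p T) J ∧ elim K T p J g = algebraMap _ _ g) →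
      ∃ (N : ℕ) (g : BiPoly K σ τ), X p ^ N * (f + f') - g ∈ linIdeal K (insert p T) J ∧
        elim K T p J g = algebraMap _ _ g := by
    rintro f f' ⟨N, g, hg, hg'⟩ ⟨N', h, hh, hh'⟩
    refine ⟨N + N', X p ^ N' * g + X p ^ N * h, ?_, ?_⟩
    · have := Ideal.add_mem _ (Ideal.mul_mem_left _ (X p ^ N') hg)
        (Ideal.mul_mem_left _ (X p ^ N) hh)
      convert this using 1
      ring
    · simp only [map_add, map_mul, map_pow, elim_X, hg', hh']
  have hmul : ∀ f f' : BiPoly K σ τ, (∃ (N : ℕ) (g : BiPoly K σ τ),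
      X p ^ N * f - g ∈ linIdeal K (insert p T) J ∧ elim K T p J g = algebraMap _ _ g) →
      (∃ (N : ℕ) (g : BiPoly K σ τ),
      X p ^ N * f' - g ∈ linIdeal K (insert p T) J ∧ elim K T p J g = algebraMap _ _ g) →
      ∃ (N : ℕ) (g : BiPoly K σ τ), X p ^ N * (f * f') - g ∈ linIdeal K (insert p T) J ∧
        elim K T p J g = algebraMap _ _ g := by
    rintro f f' ⟨N, g, hg, hg'⟩ ⟨N', h, hh, hh'⟩
    refine ⟨N + N', g * h, ?_, ?_⟩
    · have := Ideal.add_mem _ (Ideal.mul_mem_left _ (X p ^ N' * f') hg)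
        (Ideal.mul_mem_left _ g hh)
      convert this using 1
      ring
    · simp only [map_mul, hg', hh']
  have hX : ∀ i, ∃ (N : ℕ) (g : BiPoly K σ τ),
      X p ^ N * X i - g ∈ linIdeal K (insert p T) J ∧ elim K T p J g = algebraMap _ _ g :=
    fun i => ⟨0, X i, by simp, elim_X ..⟩
  have hC : ∀ s, ∃ (N : ℕ) (g : BiPoly K σ τ),
      X p ^ N * C s - g ∈ linIdeal K (insert p T) J ∧ elim K T p J g = algebraMap _ _ g := by
    intro s
    induction s using MvPolynomial.induction_on with
    | C a =>
      refine ⟨0, C (C a), by simp, ?_⟩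
      simp only [elim, coe_eval₂Hom, eval₂_C]
      rfl
    | add s t hs ht => rw [map_add]; exact hadd _ _ hs ht
    | mul_X s ij hs =>
      rw [map_mul]
      refine hmul _ _ hs ?_
      obtain ⟨i, j⟩ := ij
      by_cases h : i = p ∧ j ∈ J
      · refine ⟨1, - lin K T j, ?_, ?_⟩
        · have e : X p ^ 1 * C (X (i, j)) - - lin K T j = lin K (insert p T) j := by
            rw [lin, lin, Finset.sum_insert hp, h.1]; ring
          rw [e]
          exact lin_mem_linIdeal h.2
        · rw [map_neg, map_neg, elim_lin_of_notMem hp]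
      · refine ⟨0, C (X (i, j)), by simp, ?_⟩
        rw [elim_C_X, if_neg h]
  induction f using MvPolynomial.induction_on with
  | C s => exact hC s
  | add f g hf hg => exact hadd _ _ hf hg
  | mul_X f i hf => exact hmul _ _ hf (hX i)

lemma exists_pow_mul_mem {T : Finset σ} {p : σ} (hp : p ∉ T) {J : Finset τ}
    {f : BiPoly K σ τ} (hf : elim K T p J f = 0) :
    ∃ N : ℕ, X p ^ N * f ∈ linIdeal K (insert p T) J := by
  obtain ⟨N, g, hg, hg'⟩ := exists_pow_mul_sub_mem hp J f
  have := elim_eq_zero_of_mem hp hg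
  rw [map_sub, map_mul, hf, mul_zero, zero_sub, neg_eq_zero, hg',
    FaithfulSMul.algebraMap_eq_zero_iff] at this
  exact ⟨N, by simpa [this] using hg⟩

lemma mem_linIdeal_of_elim_eq_zero {T : Finset σ} (hT : IsRegularForms K τ T) {p : σ}
    (hp : p ∉ T) {J : Finset τ} {f : BiPoly K σ τ} (hf : f ∈ varIdeal K τ (insert p T))
    (h : elim K T p J f = 0) : f ∈ linIdeal K (insert p T) J := by
  obtain ⟨N, hN⟩ := exists_pow_mul_mem hp h
  clear h
  induction N with
  | zero => simpa using hN
  | succ N ih =>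
    apply ih
    obtain ⟨q, hq⟩ := mem_linIdeal_iff.1 hN
    have hmem : ∑ j ∈ J, lin K (insert p T) j * q j ∈ varIdeal K τ (insert p T) ^ 2 := by
      rw [← hq, pow_two, pow_succ', mul_assoc]
      exact Ideal.mul_mem_mul (X_mem_varIdeal (Finset.mem_insert_self p T))
        (Ideal.mul_mem_left _ _ hf)
    rw [sum_lin_mul_eq_of_mem hmem, pow_succ', mul_assoc] at hq
    exact mem_linIdeal_of_X_mul hT hp J _ _ (fun j => sub_evZero_mem _ _) hq

lemma lin_ne_zero {T : Finset σ} {p : σ} (hp : p ∈ T) (j : τ) : lin K T j ≠ 0 := by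
  intro h
  have := congrArg (eval (Pi.single p 1)) h
  simp only [lin, map_sum, map_mul, eval_X, eval_C, Pi.single_apply, ite_mul, one_mul, zero_mul,
    Finset.sum_ite_eq', hp, if_true, map_zero] at this
  exact X_ne_zero _ this

lemma isRegularForms (T : Finset σ) : IsRegularForms K τ T := by
  induction T using Finset.induction_on with
  | empty =>
    intro J c _ q hq _
    rw [varIdeal, Finset.coe_empty, Set.image_empty, Ideal.span_empty, Ideal.mem_bot] at hq
    rw [hq]; exact Ideal.zero_mem _
  | insert p T hp ih =>
    intro J c hc q hq h
    refine mem_linIdeal_of_elim_eq_zero ih hp hq ?_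
    have h0 := elim_eq_zero_of_mem hp h
    rw [map_mul, mul_eq_zero] at h0
    refine h0.resolve_left ?_
    have : elim K T p J (lin K (insert p T) c) = algebraMap _ _ (lin K (insert p T) c) := by
      rw [lin, map_sum, map_sum]
      refine Finset.sum_congr rfl fun i _ => ?_
      have hne : ¬(i = p ∧ c ∈ J) := fun h => hc h.2
      rw [map_mul, map_mul, elim_X, elim_C_X, if_neg hne]
    rw [this]
    intro h
    rw [FaithfulSMul.algebraMap_eq_zero_iff] at h
    exact lin_ne_zero (Finset.mem_insert_self p T) c h

end GenericMatrix

/-! ### Fermionic Fock relations in a ring -/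

/-- Creation operators `e`, annihilation operators `d` and degree projections `p` satisfying the
canonical anticommutation relations, `p 0` being the projection to the vacuum. -/
structure IsFock {σ M : Type*} [Ring M] [Fintype σ] (e d : σ → M) (p : ℕ → M) : Prop where
  d_add : ∀ i j, d i * d j + d j * d i = 0
  d_sq : ∀ i, d i * d i = 0
  d_e : ∀ i, d i * e i + e i * d i = 1
  d_e_of_ne : ∀ i j, i ≠ j → d i * e j + e j * d i = 0
  p_d : ∀ a i, p a * d i = d i * p (a + 1)
  p_e : ∀ a i, p (a + 1) * e i = e i * p a
  p_zero_e : ∀ i, p 0 * e i = 0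
  d_p_zero : ∀ i, d i * p 0 = 0
  p_mul_self : ∀ a, p a * p a = p a
  p_mul_of_ne : ∀ a b, a ≠ b → p a * p b = 0
  p_zero : p 0 = (Finset.univ.toList.map fun i => d i * e i).prod

/-- The additive closure of the fixed space of `p₀` under left multiplication by the `θ j`. -/
inductive VacSpan {M τ : Type*} [Ring M] (p₀ : M) (θ : τ → M) : M → Prop
  | vac (r : M) (hr : p₀ * r = r) : VacSpan p₀ θ r
  | add (r s : M) (hr : VacSpan p₀ θ r) (hs : VacSpan p₀ θ s) : VacSpan p₀ θ (r + s)
  | mul (j : τ) (r : M) (hr : VacSpan p₀ θ r) : VacSpan p₀ θ (θ j * r)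

namespace VacSpan

variable {M τ : Type*} [Ring M] {p₀ : M} {θ : τ → M}

lemma zero : VacSpan p₀ θ 0 := vac 0 (mul_zero _)

lemma smul {S : Type*} [CommRing S] [Algebra S M] (c : S) {r : M} (hr : VacSpan p₀ θ r) :
    VacSpan p₀ θ (c • r) := by
  induction hr with
  | vac r hr => exact vac _ (by rw [mul_smul_comm, hr])
  | add r s _ _ hr hs => rw [smul_add]; exact add _ _ hr hs
  | mul j r _ hr => rw [← mul_smul_comm]; exact mul _ _ hr

lemma mul_of_mem_span {S : Type*} [CommRing S] [Algebra S M] {t r : M}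
    (ht : t ∈ Submodule.span S (Set.range θ)) (hr : VacSpan p₀ θ r) : VacSpan p₀ θ (t * r) := by
  induction ht using Submodule.span_induction with
  | mem x hx => obtain ⟨j, rfl⟩ := hx; exact mul _ _ hr
  | zero => rw [zero_mul]; exact zero
  | add x y _ _ hx hy => rw [add_mul]; exact add _ _ hx hy
  | smul c x _ hx => rw [smul_mul_assoc]; exact smul c hx

end VacSpan

namespace IsFock

variable {σ M : Type*} [Ring M] [Fintype σ] {e d : σ → M} {p : ℕ → M}

lemma map {M' : Type*} [Ring M'] (h : IsFock e d p) (f : M →+* M') :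
    IsFock (fun i => f (e i)) (fun i => f (d i)) (fun a => f (p a)) where
  d_add i j := by rw [← map_mul, ← map_mul, ← map_add, h.d_add, map_zero]
  d_sq i := by rw [← map_mul, h.d_sq, map_zero]
  d_e i := by rw [← map_mul, ← map_mul, ← map_add, h.d_e, map_one]
  d_e_of_ne i j hij := by
    rw [← map_mul, ← map_mul, ← map_add, h.d_e_of_ne i j hij, map_zero]
  p_d a i := by rw [← map_mul, ← map_mul, h.p_d]
  p_e a i := by rw [← map_mul, ← map_mul, h.p_e]
  p_zero_e i := by rw [← map_mul, h.p_zero_e, map_zero]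
  d_p_zero i := by rw [← map_mul, h.d_p_zero, map_zero]
  p_mul_self a := by rw [← map_mul, h.p_mul_self]
  p_mul_of_ne a b hab := by rw [← map_mul, h.p_mul_of_ne a b hab, map_zero]
  p_zero := by rw [h.p_zero, map_list_prod, List.map_map]; simp [Function.comp_def]

lemma d_mul_d (h : IsFock e d p) (i j : σ) : d i * d j = -(d j * d i) :=
  eq_neg_of_add_eq_zero_left (h.d_add i j)

lemma d_mul_e (h : IsFock e d p) {i j : σ} (hij : i ≠ j) : d i * e j = -(e j * d i) :=
  eq_neg_of_add_eq_zero_left (h.d_e_of_ne i j hij)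

lemma e_mul_d (h : IsFock e d p) (i : σ) : e i * d i = 1 - d i * e i :=
  eq_sub_of_add_eq' (h.d_e i)

lemma p_zero_mul (h : IsFock e d p) {u : M} (hu : ∀ i, d i * u = 0) : p 0 * u = u := by
  rw [h.p_zero]
  have : ∀ l : List σ, (l.map fun i => d i * e i).prod * u = u := by
    intro l
    induction l with
    | nil => simp
    | cons i l ih =>
      rw [List.map_cons, List.prod_cons, mul_assoc, ih, eq_sub_of_add_eq (h.d_e i), sub_mul,
        one_mul, mul_assoc, hu, mul_zero, sub_zero]
  exact this _

lemma exists_adjoin_mul {S : Type*} [CommRing S] [Algebra S M] (h : IsFock e d p)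
    (hs : ∀ r, ∃ c : S, p 0 * r * p 0 = c • p 0) (s : Finset σ) :
    ∀ (a : ℕ) (r z : M), p 0 * r = r → p a * z = z → (∀ i, i ∉ s → d i * z = 0) →
      ∃ w ∈ Algebra.adjoin S (Set.range d), r * z = p 0 * w * z := by
  classical
  induction s using Finset.induction_on with
  | empty =>
    intro a r z hr hz hd
    have hz0 : p 0 * z = z := h.p_zero_mul fun i => hd i (Finset.notMem_empty i)
    rcases Nat.eq_zero_or_pos a with rfl | ha
    · obtain ⟨c, hc⟩ := hs r
      refine ⟨algebraMap S M c, Subalgebra.algebraMap_mem _ c, ?_⟩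
      calc r * z = p 0 * r * p 0 * z := by rw [hr, mul_assoc, hz0]
        _ = p 0 * algebraMap S M c * z := by
          rw [hc, Algebra.smul_def, Algebra.commutes]
    · refine ⟨0, Subalgebra.zero_mem _, ?_⟩
      rw [← hz, ← hz0, ← mul_assoc (p a), h.p_mul_of_ne a 0 ha.ne']
      simp
  | insert k s hk ih =>
    intro a r z hr hz hd
    have hsplit : z = e k * (d k * z) + d k * e k * z := by
      rw [← mul_assoc, ← add_mul, add_comm, h.d_e, one_mul]
    obtain ⟨w₂, hw₂, h₂⟩ := ih a r (d k * e k * z) hr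
      (by rw [← mul_assoc, ← mul_assoc, h.p_d, mul_assoc (d k), h.p_e, mul_assoc, mul_assoc, hz,
        mul_assoc])
      (by
        intro i hi
        by_cases hik : i = k
        · rw [hik, ← mul_assoc, ← mul_assoc, h.d_sq, zero_mul, zero_mul]
        · rw [← mul_assoc, ← mul_assoc, h.d_mul_d, neg_mul, mul_assoc (d k), h.d_mul_e hik,
            mul_neg, neg_neg, mul_assoc, mul_assoc, hd i (by simp [hik, hi]), mul_zero,
            mul_zero])
    rcases a with - | a
    · refine ⟨w₂, hw₂, ?_⟩
      have : d k * z = 0 := by rw [← hz, ← mul_assoc, h.d_p_zero, zero_mul]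
      rw [this, mul_zero, zero_add] at hsplit
      rw [← hsplit] at h₂
      exact h₂
    · obtain ⟨w₁, hw₁, h₁⟩ := ih a ((r - p 0 * w₂) * e k) (d k * z)
        (by rw [← mul_assoc, mul_sub, hr, ← mul_assoc, h.p_mul_self])
        (by rw [← mul_assoc, h.p_d, mul_assoc, hz])
        (by
          intro i hi
          by_cases hik : i = k
          · rw [hik, ← mul_assoc, h.d_sq, zero_mul]
          · rw [← mul_assoc, h.d_mul_d, neg_mul, mul_assoc, hd i (by simp [hik, hi]), mul_zero,
              neg_zero])
      refine ⟨w₂ + w₁ * d k, Subalgebra.add_mem _ hw₂ (Subalgebra.mul_mem _ hw₁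
        (Algebra.subset_adjoin ⟨k, rfl⟩)), ?_⟩
      have e₁ : p 0 * (w₂ + w₁ * d k) * z = p 0 * w₂ * z + p 0 * w₁ * (d k * z) := by
        noncomm_ring
      rw [e₁, ← h₁]
      have e₂ : p 0 * w₂ * z = p 0 * w₂ * (e k * (d k * z)) + p 0 * w₂ * (d k * e k * z) := by
        rw [← mul_add, ← hsplit]
      have e₃ : r * z = r * (e k * (d k * z)) + r * (d k * e k * z) := by
        rw [← mul_add, ← hsplit]
      rw [e₂, ← h₂, e₃]
      noncomm_ring

/-- An element of `VacSpan` agrees in each bidegree with an element of the Clifford algebra. -/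
lemma exists_adjoin_of_vacSpan {S τ : Type*} [CommRing S] [Algebra S M] (h : IsFock e d p)
    (hs : ∀ r, ∃ c : S, p 0 * r * p 0 = c • p 0) {θ : τ → M}
    (hθ : ∀ a j, p (a + 1) * θ j = θ j * p a) (hθ₀ : ∀ j, p 0 * θ j = 0) {z : M}
    (hz : VacSpan (p 0) θ z) : ∀ a b, ∃ w ∈ Algebra.adjoin S (Set.range θ ∪ Set.range d),
      p b * z * p a = p b * w * p a := by
  induction hz with
  | vac r hr =>
    intro a b
    rcases Nat.eq_zero_or_pos b with rfl | hb
    · obtain ⟨w, hw, hw'⟩ := h.exists_adjoin_mul hs Finset.univ a r (p a) hr (h.p_mul_self a)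
        (by simp)
      exact ⟨w, Algebra.adjoin_mono Set.subset_union_right hw, by rw [hr, hw']⟩
    · refine ⟨0, Subalgebra.zero_mem _, ?_⟩
      rw [← hr, ← mul_assoc, h.p_mul_of_ne b 0 hb.ne']
      simp
  | add r s _ _ hr hs' =>
    intro a b
    obtain ⟨w, hw, h₁⟩ := hr a b
    obtain ⟨w', hw', h₂⟩ := hs' a b
    exact ⟨w + w', Subalgebra.add_mem _ hw hw', by simp only [mul_add, add_mul, h₁, h₂]⟩
  | mul j r _ hr =>
    intro a b
    rcases b with - | b
    · exact ⟨0, Subalgebra.zero_mem _, by rw [← mul_assoc, hθ₀]; simp⟩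
    · obtain ⟨w, hw, h₁⟩ := hr a b
      refine ⟨θ j * w, Subalgebra.mul_mem _
        (Algebra.subset_adjoin (Or.inl ⟨j, rfl⟩)) hw, ?_⟩
      rw [← mul_assoc, hθ, mul_assoc, mul_assoc, ← mul_assoc (p b), h₁, ← mul_assoc (p _), hθ]
      simp only [mul_assoc]

/-- The kernel of a nonzero annihilation operator `∑ y i • d i`. -/
lemma vacSpan_of_mul_eq_zero {F τ : Type*} [Field F] [Algebra F M] (h : IsFock e d p)
    (y : σ → F) {k₀ : σ} (hy : y k₀ ≠ 0) {θ : τ → M}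
    (hθ : ∀ q, q ≠ k₀ → e q - (y q / y k₀) • e k₀ ∈ Submodule.span F (Set.range θ))
    (s : Finset σ) : ∀ u : M, (∑ i, y i • d i) * u = 0 →
      (∀ q, q ∉ s → q ≠ k₀ → d q * u = 0) → VacSpan (p 0) θ u := by
  classical
  set D := ∑ i, y i • d i with hD
  have hDd : ∀ k, D * d k = -(d k * D) := by
    intro k
    rw [hD, Finset.sum_mul, Finset.mul_sum, ← Finset.sum_neg_distrib]
    refine Finset.sum_congr rfl fun i _ => ?_
    rw [smul_mul_assoc, mul_smul_comm, h.d_mul_d i k, smul_neg]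
  have hDe : ∀ k, D * e k + e k * D = y k • (1 : M) := by
    intro k
    rw [hD, Finset.sum_mul, Finset.mul_sum, ← Finset.sum_add_distrib,
      Finset.sum_eq_single k]
    · rw [smul_mul_assoc, mul_smul_comm, ← smul_add, h.d_e]
    · intro i _ hik
      rw [smul_mul_assoc, mul_smul_comm, ← smul_add, h.d_e_of_ne i k hik, smul_zero]
    · simp
  induction s using Finset.induction_on with
  | empty =>
    intro u hu hd
    refine VacSpan.vac u (h.p_zero_mul fun i => ?_)
    by_cases hi : i = k₀
    · subst hi
      rw [hD, Finset.sum_mul, Finset.sum_eq_single i] at hu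
      · rw [smul_mul_assoc] at hu
        exact (smul_eq_zero_iff_right hy).1 hu
      · intro q _ hq
        rw [smul_mul_assoc, hd q (Finset.notMem_empty q) hq, smul_zero]
      · simp
    · exact hd i (Finset.notMem_empty i) hi
  | insert k s hk ih =>
    intro u hu hd
    by_cases hk₀ : k = k₀
    · refine ih u hu fun q hq hq' => hd q ?_ hq'
      simp [hq, hq', hk₀]
    set e' := e k - (y k / y k₀) • e k₀ with he'
    have hDe' : D * e' = -(e' * D) := by
      rw [eq_neg_iff_add_eq_zero]
      have : D * e' + e' * D = D * e k + e k * D -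
          (y k / y k₀) • (D * e k₀ + e k₀ * D) := by
        rw [he', mul_sub, sub_mul, mul_smul_comm, smul_mul_assoc, smul_add]; abel
      rw [this, hDe, hDe, smul_smul, div_mul_cancel₀ _ hy, sub_self]
    have hdk : d k * e' + e' * d k = 1 := by
      have : d k * e' + e' * d k = d k * e k + e k * d k -
          (y k / y k₀) • (d k * e k₀ + e k₀ * d k) := by
        rw [he', mul_sub, sub_mul, mul_smul_comm, smul_mul_assoc, smul_add]; abel
      rw [this, h.d_e, h.d_e_of_ne _ _ hk₀, smul_zero, sub_zero]
    have hdq : ∀ q, q ≠ k → q ≠ k₀ → d q * e' = -(e' * d q) := by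
      intro q h₁ h₂
      rw [eq_neg_iff_add_eq_zero]
      have : d q * e' + e' * d q = d q * e k + e k * d q -
          (y k / y k₀) • (d q * e k₀ + e k₀ * d q) := by
        rw [he', mul_sub, sub_mul, mul_smul_comm, smul_mul_assoc, smul_add]; abel
      rw [this, h.d_e_of_ne _ _ h₁, h.d_e_of_ne _ _ h₂, smul_zero, sub_zero]
    have hsplit : u = e' * (d k * u) + d k * e' * u := by
      rw [← mul_assoc, ← add_mul, add_comm, hdk, one_mul]
    rw [hsplit]
    refine VacSpan.add _ _ (VacSpan.mul_of_mem_span (hθ k hk₀) (ih _ ?_ ?_)) (ih _ ?_ ?_)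
    · rw [← mul_assoc, hDd, neg_mul, mul_assoc, hu, mul_zero, neg_zero]
    · intro q hq hq'
      by_cases hqk : q = k
      · rw [hqk, ← mul_assoc, h.d_sq, zero_mul]
      · rw [← mul_assoc, h.d_mul_d, neg_mul, mul_assoc, hd q (by simp [hq, hqk]) hq', mul_zero,
          neg_zero]
    · rw [← mul_assoc, ← mul_assoc, hDd, neg_mul, mul_assoc (d k), hDe', mul_neg, neg_neg,
        mul_assoc, mul_assoc, hu, mul_zero, mul_zero]
    · intro q hq hq'
      by_cases hqk : q = k
      · rw [hqk, ← mul_assoc, ← mul_assoc, h.d_sq, zero_mul, zero_mul]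
      · rw [← mul_assoc, ← mul_assoc, h.d_mul_d, neg_mul, mul_assoc (d k), hdq q hqk hq',
          mul_neg, neg_neg, mul_assoc, mul_assoc, hd q (by simp [hq, hqk]) hq', mul_zero,
          mul_zero]

/-- The first cohomology of right multiplication by the `d i` vanishes. -/
lemma exists_eq_mul_d (h : IsFock e d p) {x : σ → M} (h₀ : ∀ i, x i * d i = 0)
    (h₁ : ∀ i j, x i * d j + x j * d i = 0) : ∃ t : M, ∀ i, x i = t * d i := by
  classical
  suffices ∀ s : Finset σ, ∃ t : M, ∀ i ∈ s, x i = t * d i by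
    obtain ⟨t, ht⟩ := this Finset.univ
    exact ⟨t, fun i => ht i (Finset.mem_univ i)⟩
  intro s
  induction s using Finset.induction_on with
  | empty => exact ⟨0, by simp⟩
  | insert k s hk ih =>
    obtain ⟨t, ht⟩ := ih
    refine ⟨t + (x k - t * d k) * e k, fun i hi => ?_⟩
    by_cases hik : i = k
    · subst hik
      have e₁ : (x i - t * d i) * d i = 0 := by
        rw [sub_mul, h₀, mul_assoc, h.d_sq, mul_zero, sub_zero]
      rw [add_mul, mul_assoc (x i - _), h.e_mul_d, mul_sub, ← mul_assoc, e₁]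
      simp
    · have his : i ∈ s := (Finset.mem_insert.1 hi).resolve_left hik
      have e₁ : (x k - t * d k) * d i = 0 := by
        have := h₁ k i
        rw [ht i his] at this
        rw [sub_mul, mul_assoc, h.d_mul_d k i, mul_neg, ← mul_assoc, sub_neg_eq_add]
        exact this
      have e₂ : e k * d i = -(d i * e k) := by rw [h.d_mul_e hik, neg_neg]
      rw [add_mul, mul_assoc (x k - _), e₂, mul_neg, ← mul_assoc, e₁, ht i his]
      simp

end IsFock

/-! ### Matrices over the bihomogeneous polynomial ring -/

namespace GenericMatrix

open MvPolynomial Matrix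

set_option linter.unusedSectionVars false

variable {K : Type} [Field K] {σ τ β : Type} [Fintype σ] [DecidableEq σ] [DecidableEq τ]
  [Fintype β] [DecidableEq β]

/-- Scalar extension of matrices along the inclusion of the constants. -/
def extC (K : Type) [Field K] (σ τ β : Type) [Fintype β] [DecidableEq β] :
    Matrix β β (MvPolynomial (σ × τ) K) →+* Matrix β β (BiPoly K σ τ) :=
  (C : MvPolynomial (σ × τ) K →+* BiPoly K σ τ).mapMatrix

/-- The generic combination `∑ y_i d_i`. -/
def genSum (d : σ → Matrix β β (MvPolynomial (σ × τ) K)) : Matrix β β (BiPoly K σ τ) :=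
  ∑ i, (X i : BiPoly K σ τ) • extC K σ τ β (d i)

/-- The combination `∑ x_{ij} e_i`. -/
def colSum (e : σ → Matrix β β (MvPolynomial (σ × τ) K)) (j : τ) :
    Matrix β β (MvPolynomial (σ × τ) K) :=
  ∑ i, (X (i, j) : MvPolynomial (σ × τ) K) • e i

/-- Matrices with entries in the ideal `linIdeal`. -/
def linMat (K : Type) [Field K] (σ : Type) {τ : Type} (β : Type) [Fintype σ] (J : Finset τ) :
    Submodule (BiPoly K σ τ) (Matrix β β (BiPoly K σ τ)) where
  carrier := {Y | ∀ i j, Y i j ∈ linIdeal K Finset.univ J}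
  add_mem' hX hY i j := Ideal.add_mem _ (hX i j) (hY i j)
  zero_mem' _ _ := Ideal.zero_mem _
  smul_mem' c _ hX i j := Ideal.mul_mem_left _ c (hX i j)

/-- Matrices whose entries are homogeneous of degree `k` in the variables `y_i`. -/
def IsHomMat (k : ℕ) (Y : Matrix β β (BiPoly K σ τ)) : Prop :=
  ∀ i j, (Y i j).IsHomogeneous k

lemma mem_linMat {J : Finset τ} {Y : Matrix β β (BiPoly K σ τ)} :
    Y ∈ linMat K σ β J ↔ ∀ i j, Y i j ∈ linIdeal K Finset.univ J := Iff.rfl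

lemma linMat_mono {J J' : Finset τ} (h : J ⊆ J') : linMat K σ β J ≤ linMat K σ β J' :=
  fun _ hY i j => linIdeal_mono _ h (hY i j)

lemma mul_mem_linMat_left {J : Finset τ} (Z : Matrix β β (BiPoly K σ τ))
    {Y : Matrix β β (BiPoly K σ τ)} (hY : Y ∈ linMat K σ β J) : Z * Y ∈ linMat K σ β J :=
  fun i j => by
    rw [Matrix.mul_apply]
    exact Ideal.sum_mem _ fun k _ => Ideal.mul_mem_left _ _ (hY k j)

lemma mul_mem_linMat_right {J : Finset τ} {Y : Matrix β β (BiPoly K σ τ)}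
    (hY : Y ∈ linMat K σ β J) (Z : Matrix β β (BiPoly K σ τ)) : Y * Z ∈ linMat K σ β J :=
  fun i j => by
    rw [Matrix.mul_apply]
    exact Ideal.sum_mem _ fun k _ => Ideal.mul_mem_right _ _ (hY i k)

lemma lin_smul_mem_linMat {J : Finset τ} {c : τ} (hc : c ∈ J) (Z : Matrix β β (BiPoly K σ τ)) :
    lin K (Finset.univ : Finset σ) c • Z ∈ linMat K σ β J :=
  fun _ _ => Ideal.mul_mem_right _ _ (lin_mem_linIdeal hc)

namespace IsHomMat

lemma mul {k l : ℕ} {Y Z : Matrix β β (BiPoly K σ τ)} (hY : IsHomMat k Y) (hZ : IsHomMat l Z) :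
    IsHomMat (k + l) (Y * Z) := fun i j => by
  rw [Matrix.mul_apply]
  exact IsHomogeneous.sum _ _ _ fun r _ => (hY i r).mul (hZ r j)

lemma sub {k : ℕ} {Y Z : Matrix β β (BiPoly K σ τ)} (hY : IsHomMat k Y) (hZ : IsHomMat k Z) :
    IsHomMat k (Y - Z) := fun i j => (hY i j).sub (hZ i j)

lemma extC (V : Matrix β β (MvPolynomial (σ × τ) K)) : IsHomMat 0 (extC K σ τ β V) :=
  fun _ _ => isHomogeneous_C _ _

lemma lin_smul {k : ℕ} (c : τ) {Y : Matrix β β (BiPoly K σ τ)} (hY : IsHomMat k Y) :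
    IsHomMat (k + 1) (lin K (Finset.univ : Finset σ) c • Y) := fun i j => by
  have : (lin K (Finset.univ : Finset σ) c : BiPoly K σ τ).IsHomogeneous 1 :=
    IsHomogeneous.sum _ _ _ fun r _ => by
      simpa using (isHomogeneous_X _ r).mul (isHomogeneous_C σ (X (r, c)))
  rw [add_comm]
  exact this.mul (hY i j)

lemma genSum (d : σ → Matrix β β (MvPolynomial (σ × τ) K)) : IsHomMat 1 (genSum d) := by
  intro i j
  rw [GenericMatrix.genSum, Matrix.sum_apply]
  refine IsHomogeneous.sum _ _ _ fun r _ => ?_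
  exact (isHomogeneous_X (MvPolynomial (σ × τ) K) r).mul (isHomogeneous_C σ (d r i j))

lemma mem_varIdeal {k : ℕ} {f : BiPoly K σ τ} (hf : f.IsHomogeneous (k + 1)) :
    f ∈ varIdeal K τ Finset.univ := by
  have h := sub_evZero_mem (K := K) (τ := τ) Finset.univ f
  have : evZero K τ Finset.univ f = 0 := by
    have e : evZero K τ (Finset.univ : Finset σ) = aeval 0 := by
      apply MvPolynomial.algHom_ext
      simp [evZero]
    rw [e, aeval_zero]
    have : constantCoeff f = 0 := by
      rw [constantCoeff_eq]
      by_contra h0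
      have := hf h0
      simp at this
    rw [this, map_zero]
  rwa [this, sub_zero] at h

lemma exists_extC {Y : Matrix β β (BiPoly K σ τ)} (hY : IsHomMat 0 Y) :
    ∃ V, Y = GenericMatrix.extC K σ τ β V := by
  refine ⟨fun i j => coeff 0 (Y i j), ?_⟩
  ext1 i j
  exact totalDegree_eq_zero_iff_eq_C.1
    (Nat.le_zero.1 (hY i j).totalDegree_le)

lemma exists_sum {Y : Matrix β β (BiPoly K σ τ)} (hY : IsHomMat 1 Y) :
    ∃ V : σ → Matrix β β (MvPolynomial (σ × τ) K),
      Y = ∑ i, (X i : BiPoly K σ τ) • GenericMatrix.extC K σ τ β (V i) := by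
  have : ∀ i j, ∃ v : σ → MvPolynomial (σ × τ) K, ∑ k, v k • (X k : BiPoly K σ τ) = Y i j := by
    intro i j
    have h := (mem_homogeneousSubmodule 1 (Y i j)).2 (hY i j)
    rw [homogeneousSubmodule_one_eq_span_X] at h
    exact (Submodule.mem_span_range_iff_exists_fun _).1 h
  choose v hv using this
  refine ⟨fun k i j => v i j k, ?_⟩
  ext1 i j
  rw [← hv, Matrix.sum_apply]
  refine Finset.sum_congr rfl fun k _ => ?_
  rw [smul_eq_C_mul, mul_comm]
  rfl

end IsHomMat

lemma homogeneousComponent_lin_mul (T : Finset σ) (c : τ) (q : BiPoly K σ τ) (k : ℕ) :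
    homogeneousComponent (k + 1) (lin K T c * q) = lin K T c * homogeneousComponent k q := by
  have hl : (lin K T c : BiPoly K σ τ).IsHomogeneous 1 :=
    IsHomogeneous.sum _ _ _ fun r _ => by
      simpa using (isHomogeneous_X _ r).mul (isHomogeneous_C σ (X (r, c)))
  conv_lhs => rw [← sum_homogeneousComponent q, Finset.mul_sum, map_sum]
  have : ∀ i, homogeneousComponent (k + 1) (lin K T c * homogeneousComponent i q) =
      if i = k then lin K T c * homogeneousComponent i q else 0 := by
    intro i
    have := hl.mul (homogeneousComponent_isHomogeneous i q)
    rw [homogeneousComponent_of_mem this]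
    congr 1
    rw [eq_iff_iff]
    omega
  simp only [this, Finset.sum_ite_eq']
  split_ifs with h
  · rfl
  · rw [homogeneousComponent_eq_zero, mul_zero]
    simpa using h

lemma exists_sub_lin_smul_mem {J : Finset τ} {c : τ} (hc : c ∉ J) {k : ℕ}
    {Y : Matrix β β (BiPoly K σ τ)} (hY : IsHomMat (k + 1) Y)
    (hm : Y ∈ linMat K σ β (insert c J)) :
    ∃ Q, IsHomMat k Q ∧ Y - lin K (Finset.univ : Finset σ) c • Q ∈ linMat K σ β J := by
  have : ∀ i j, ∃ q : BiPoly K σ τ, q.IsHomogeneous k ∧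
      Y i j - lin K (Finset.univ : Finset σ) c * q ∈ linIdeal K Finset.univ J := by
    intro i j
    obtain ⟨q, hq⟩ := mem_linIdeal_iff.1 (hm i j)
    refine ⟨homogeneousComponent k (q c), homogeneousComponent_isHomogeneous _ _, ?_⟩
    rw [Finset.sum_insert hc] at hq
    have h := congrArg (homogeneousComponent (k + 1)) hq
    rw [homogeneousComponent_of_mem (hY i j), if_pos rfl, map_add, map_sum,
      homogeneousComponent_lin_mul] at h
    rw [h, add_sub_cancel_left]
    refine Ideal.sum_mem _ fun r hr => ?_
    rw [homogeneousComponent_lin_mul]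
    exact Ideal.mul_mem_right _ _ (lin_mem_linIdeal hr)
  choose q hq hq' using this
  exact ⟨fun i j => q i j, hq, hq'⟩

lemma mem_linMat_of_lin_smul_mem {J : Finset τ} {c : τ} (hc : c ∉ J) {k : ℕ}
    {Y : Matrix β β (BiPoly K σ τ)} (hY : IsHomMat (k + 1) Y)
    (hm : lin K (Finset.univ : Finset σ) c • Y ∈ linMat K σ β J) : Y ∈ linMat K σ β J :=
  fun i j => isRegularForms _ J c hc _ (IsHomMat.mem_varIdeal (hY i j)) (hm i j)

lemma linMat_empty {Y : Matrix β β (BiPoly K σ τ)} :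
    Y ∈ linMat K σ β (∅ : Finset τ) ↔ Y = 0 := by
  rw [mem_linMat]
  simp only [linIdeal, Finset.coe_empty, Set.image_empty, Ideal.span_empty, Ideal.mem_bot]
  exact ⟨fun h => Matrix.ext h, fun h i j => by rw [h]; rfl⟩

/-- Evaluation of matrices at a point `y = v`. -/
def evalMat (v : σ → MvPolynomial (σ × τ) K) :
    Matrix β β (BiPoly K σ τ) →+* Matrix β β (MvPolynomial (σ × τ) K) :=
  (eval v).mapMatrix

lemma evalMat_extC (v : σ → MvPolynomial (σ × τ) K) (V : Matrix β β (MvPolynomial (σ × τ) K)) :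
    evalMat v (extC K σ τ β V) = V := by
  ext1 i j
  exact eval_C _

lemma evalMat_smul (v : σ → MvPolynomial (σ × τ) K) (f : BiPoly K σ τ)
    (Y : Matrix β β (BiPoly K σ τ)) : evalMat v (f • Y) = eval v f • evalMat v Y := by
  ext1 i j
  exact map_mul (eval v) _ _

lemma evalMat_sum (v : σ → MvPolynomial (σ × τ) K)
    (V : σ → Matrix β β (MvPolynomial (σ × τ) K)) :
    evalMat v (∑ i, (X i : BiPoly K σ τ) • extC K σ τ β (V i)) = ∑ i, v i • V i := by
  rw [map_sum]
  refine Finset.sum_congr rfl fun i _ => ?_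
  rw [evalMat_smul, evalMat_extC, eval_X]

lemma evalMat_single (i : σ) (V : σ → Matrix β β (MvPolynomial (σ × τ) K)) :
    evalMat (Pi.single i 1) (∑ i, (X i : BiPoly K σ τ) • extC K σ τ β (V i)) = V i := by
  rw [evalMat_sum, Finset.sum_eq_single i]
  · rw [Pi.single_eq_same, one_smul]
  · intro j _ hj
    rw [Pi.single_eq_of_ne hj, zero_smul]
  · simp

lemma evalMat_single_add (i k : σ) (V : σ → Matrix β β (MvPolynomial (σ × τ) K)) :
    evalMat (Pi.single i 1 + Pi.single k 1)
      (∑ i, (X i : BiPoly K σ τ) • extC K σ τ β (V i)) = V i + V k := by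
  rw [← evalMat_single i V, ← evalMat_single k V, evalMat_sum, evalMat_sum, evalMat_sum,
    ← Finset.sum_add_distrib]
  exact Finset.sum_congr rfl fun j _ => by rw [Pi.add_apply, add_smul]

section Fock

variable {e d : σ → Matrix β β (MvPolynomial (σ × τ) K)}
  {p : ℕ → Matrix β β (MvPolynomial (σ × τ) K)}

lemma genSum_mul_self (h : IsFock e d p) : genSum d * genSum d = 0 := by
  suffices ∀ s : Finset σ, (∑ i ∈ s, (X i : BiPoly K σ τ) • extC K σ τ β (d i)) *
      (∑ i ∈ s, (X i : BiPoly K σ τ) • extC K σ τ β (d i)) = 0 from this _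
  have h' := h.map (extC K σ τ β)
  intro s
  induction s using Finset.induction_on with
  | empty => simp
  | insert k s hk ih =>
    rw [Finset.sum_insert hk, add_mul, mul_add, mul_add, ih, add_zero, smul_mul_smul_comm,
      h'.d_sq, smul_zero, zero_add, Finset.mul_sum, Finset.sum_mul, ← Finset.sum_add_distrib]
    refine Finset.sum_eq_zero fun i _ => ?_
    rw [smul_mul_smul_comm, smul_mul_smul_comm, mul_comm (X i), ← smul_add, h'.d_add, smul_zero]

lemma extC_smul (f : MvPolynomial (σ × τ) K) (V : Matrix β β (MvPolynomial (σ × τ) K)) :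
    extC K σ τ β (f • V) = (C f : BiPoly K σ τ) • extC K σ τ β V := by
  ext1 i j
  exact map_mul C _ _

lemma genSum_mul_colSum (h : IsFock e d p) (j : τ) :
    genSum d * extC K σ τ β (colSum e j) + extC K σ τ β (colSum e j) * genSum d =
      lin K (Finset.univ : Finset σ) j • (1 : Matrix β β (BiPoly K σ τ)) := by
  have h' := h.map (extC K σ τ β)
  rw [colSum, map_sum, genSum, Finset.mul_sum, Finset.sum_mul, ← Finset.sum_add_distrib, lin,
    Finset.sum_smul]
  refine Finset.sum_congr rfl fun i _ => ?_
  rw [Finset.sum_mul, Finset.mul_sum, ← Finset.sum_add_distrib, Finset.sum_eq_single i]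
  · rw [extC_smul, smul_mul_smul_comm, smul_mul_smul_comm, mul_comm (C _), ← smul_add, h'.d_e]
  · intro k _ hk
    rw [extC_smul, smul_mul_smul_comm, smul_mul_smul_comm, mul_comm (C _), ← smul_add,
      h'.d_e_of_ne _ _ hk, smul_zero]
  · simp

lemma genSum_mul_d (h : IsFock e d p) (i : σ) :
    genSum d * extC K σ τ β (d i) = -(extC K σ τ β (d i) * genSum d) := by
  have h' := h.map (extC K σ τ β)
  rw [genSum, Finset.mul_sum, Finset.sum_mul, ← Finset.sum_neg_distrib]
  refine Finset.sum_congr rfl fun k _ => ?_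
  rw [smul_mul_assoc, mul_smul_comm, h'.d_mul_d k i, smul_neg]

lemma p_mul_genSum (h : IsFock e d p) (a : ℕ) :
    extC K σ τ β (p a) * genSum d = genSum d * extC K σ τ β (p (a + 1)) := by
  have h' := h.map (extC K σ τ β)
  rw [genSum, Finset.mul_sum, Finset.sum_mul]
  refine Finset.sum_congr rfl fun k _ => ?_
  rw [smul_mul_assoc, mul_smul_comm, h'.p_d]

lemma genSum_mul_p_zero (h : IsFock e d p) : genSum d * extC K σ τ β (p 0) = 0 := by
  have h' := h.map (extC K σ τ β)
  rw [genSum, Finset.sum_mul]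
  exact Finset.sum_eq_zero fun k _ => by rw [smul_mul_assoc, h'.d_p_zero, smul_zero]

lemma p_mul_colSum (h : IsFock e d p) (a : ℕ) (j : τ) :
    p (a + 1) * colSum e j = colSum e j * p a := by
  rw [colSum, Finset.mul_sum, Finset.sum_mul]
  refine Finset.sum_congr rfl fun k _ => ?_
  rw [smul_mul_assoc, mul_smul_comm, h.p_e]

lemma p_zero_mul_colSum (h : IsFock e d p) (j : τ) : p 0 * colSum e j = 0 := by
  rw [colSum, Finset.mul_sum]
  exact Finset.sum_eq_zero fun k _ => by rw [mul_smul_comm, h.p_zero_e, smul_zero]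

lemma exists_sub_mul_genSum_mem (h : IsFock e d p) (J : Finset τ) :
    ∀ Y : Matrix β β (BiPoly K σ τ), IsHomMat 1 Y → Y * genSum d ∈ linMat K σ β J →
      ∃ V, Y - extC K σ τ β V * genSum d ∈ linMat K σ β J := by
  induction J using Finset.induction_on with
  | empty =>
    intro Y hY hm
    rw [linMat_empty] at hm
    obtain ⟨V, rfl⟩ := hY.exists_sum
    have h₀ : ∀ i, V i * d i = 0 := by
      intro i
      have := congrArg (evalMat (Pi.single i 1)) hm
      rwa [map_mul, genSum, evalMat_single, evalMat_single, map_zero] at this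
    have h₁ : ∀ i j, V i * d j + V j * d i = 0 := by
      intro i j
      have := congrArg (evalMat (Pi.single i 1 + Pi.single j 1)) hm
      rw [map_mul, genSum, evalMat_single_add, evalMat_single_add, map_zero, add_mul, mul_add,
        mul_add, h₀, h₀, zero_add, add_zero] at this
      exact this
    obtain ⟨t, ht⟩ := h.exists_eq_mul_d h₀ h₁
    refine ⟨t, ?_⟩
    rw [linMat_empty, sub_eq_zero, genSum, Finset.mul_sum]
    refine Finset.sum_congr rfl fun i _ => ?_
    rw [ht, map_mul, mul_smul_comm]
  | insert c J hc ih =>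
    intro Y hY hm
    obtain ⟨Q, hQ, hYQ⟩ := exists_sub_lin_smul_mem hc (hY.mul (IsHomMat.genSum d)) hm
    have h₁ : lin K (Finset.univ : Finset σ) c • (Q * genSum d) ∈ linMat K σ β J := by
      have := mul_mem_linMat_right hYQ (genSum d)
      rw [sub_mul, mul_assoc, genSum_mul_self h, mul_zero, zero_sub, smul_mul_assoc] at this
      exact (Submodule.neg_mem_iff _).1 this
    have h₂ : Q * genSum d ∈ linMat K σ β J :=
      mem_linMat_of_lin_smul_mem hc (hQ.mul (IsHomMat.genSum d)) h₁
    obtain ⟨T, hT⟩ := ih Q hQ h₂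
    have h₃ : (Y - lin K (Finset.univ : Finset σ) c • extC K σ τ β T) * genSum d ∈ linMat K σ β J := by
      have := Submodule.add_mem _ hYQ (Submodule.smul_mem _ (lin K (Finset.univ : Finset σ) c) hT)
      convert this using 1
      rw [sub_mul, smul_sub, smul_mul_assoc]
      abel
    obtain ⟨V, hV⟩ := ih _ (hY.sub (IsHomMat.lin_smul c (IsHomMat.extC T))) h₃
    refine ⟨V, ?_⟩
    have := Submodule.add_mem _ (linMat_mono (Finset.subset_insert c J) hV)
      (lin_smul_mem_linMat (K := K) (σ := σ) (Finset.mem_insert_self c J) (extC K σ τ β T))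
    convert this using 1
    abel

lemma vacSpan_of_genSum_mul_mem (h : IsFock e d p) (J : Finset τ) :
    ∀ U : Matrix β β (MvPolynomial (σ × τ) K),
      genSum d * extC K σ τ β U ∈ linMat K σ β J → VacSpan (p 0) (colSum e) U := by
  induction J using Finset.induction_on with
  | empty =>
    intro U hm
    rw [linMat_empty] at hm
    refine VacSpan.vac U (h.p_zero_mul fun i => ?_)
    have := congrArg (evalMat (Pi.single i 1)) hm
    rwa [map_mul, genSum, evalMat_single, evalMat_extC, map_zero] at this
  | insert c J hc ih =>
    intro U hm
    obtain ⟨Q, hQ, hUQ⟩ := exists_sub_lin_smul_mem (k := 0) hc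
      ((IsHomMat.genSum d).mul (IsHomMat.extC U)) hm
    obtain ⟨V, rfl⟩ := hQ.exists_extC
    have h₁ : lin K (Finset.univ : Finset σ) c • (genSum d * extC K σ τ β V) ∈ linMat K σ β J := by
      have := mul_mem_linMat_left (genSum d) hUQ
      rw [mul_sub, ← mul_assoc, genSum_mul_self h, zero_mul, zero_sub, mul_smul_comm] at this
      exact (Submodule.neg_mem_iff _).1 this
    have h₂ : genSum d * extC K σ τ β V ∈ linMat K σ β J :=
      mem_linMat_of_lin_smul_mem (k := 0) hc ((IsHomMat.genSum d).mul (IsHomMat.extC V)) h₁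
    have h₃ : VacSpan (p 0) (colSum e) (U - colSum e c * V) := by
      apply ih
      have := Submodule.add_mem _ hUQ
        (mul_mem_linMat_left (extC K σ τ β (colSum e c)) h₂)
      convert this using 1
      rw [map_sub, map_mul, mul_sub, ← mul_assoc, eq_sub_of_add_eq (genSum_mul_colSum h c),
        sub_mul, smul_mul_assoc, one_mul, mul_assoc]
      abel
    have := VacSpan.add _ _ h₃ (VacSpan.mul c _ (ih V h₂))
    rwa [sub_add_cancel] at this

lemma exists_adjoin_sub_mem [Fintype τ] (h : IsFock e d p)
    {w : Matrix β β (MvPolynomial (σ × τ) K)}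
    (hw : w ∈ Algebra.adjoin (MvPolynomial (σ × τ) K)
      (Set.range (colSum e) ∪ Set.range d : Set (Matrix β β (MvPolynomial (σ × τ) K)))) :
    ∃ w' ∈ Algebra.adjoin (MvPolynomial (σ × τ) K) (Set.range (colSum e) ∪ Set.range d),
      genSum d * extC K σ τ β w' - extC K σ τ β w * genSum d ∈
        linMat K σ β (Finset.univ : Finset τ) := by
  induction hw using Algebra.adjoin_induction with
  | mem x hx =>
    refine ⟨-x, Subalgebra.neg_mem _ (Algebra.subset_adjoin hx), ?_⟩
    rcases hx with ⟨j, rfl⟩ | ⟨i, rfl⟩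
    · rw [map_neg, Matrix.mul_neg, ← neg_add', genSum_mul_colSum h]
      exact Submodule.neg_mem _ (lin_smul_mem_linMat (Finset.mem_univ j) _)
    · rw [map_neg, Matrix.mul_neg, genSum_mul_d h, neg_neg, sub_self]
      exact Submodule.zero_mem _
  | algebraMap r =>
    refine ⟨algebraMap _ _ r, Subalgebra.algebraMap_mem _ r, ?_⟩
    rw [Algebra.algebraMap_eq_smul_one, extC_smul, map_one, mul_smul_comm, smul_mul_assoc,
      mul_one, one_mul, sub_self]
    exact Submodule.zero_mem _
  | add x y _ _ hx hy =>
    obtain ⟨x', hx', h₁⟩ := hx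
    obtain ⟨y', hy', h₂⟩ := hy
    refine ⟨x' + y', Subalgebra.add_mem _ hx' hy', ?_⟩
    convert Submodule.add_mem _ h₁ h₂ using 1
    rw [map_add, map_add, mul_add, add_mul]
    abel
  | mul x y _ _ hx hy =>
    obtain ⟨x', hx', h₁⟩ := hx
    obtain ⟨y', hy', h₂⟩ := hy
    refine ⟨x' * y', Subalgebra.mul_mem _ hx' hy', ?_⟩
    convert Submodule.add_mem _ (mul_mem_linMat_right h₁ (extC K σ τ β y'))
      (mul_mem_linMat_left (extC K σ τ β x) h₂) using 1
    rw [map_mul, map_mul, sub_mul, mul_sub, ← mul_assoc, ← mul_assoc, mul_assoc _ (genSum d),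
      mul_assoc (extC K σ τ β x) (extC K σ τ β y), sub_add_sub_cancel]

lemma exists_adjoin_of_genSum_mul_mul_mem [Fintype τ] (h : IsFock e d p)
    (hs : ∀ r, ∃ c : MvPolynomial (σ × τ) K, p 0 * r * p 0 = c • p 0) (b : ℕ) :
    ∀ (a : ℕ) (U : Matrix β β (MvPolynomial (σ × τ) K)), p b * U * p a = U →
      genSum d * extC K σ τ β U * genSum d ∈ linMat K σ β (Finset.univ : Finset τ) →
      ∃ w ∈ Algebra.adjoin (MvPolynomial (σ × τ) K) (Set.range (colSum e) ∪ Set.range d),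
        U = p b * w * p a := by
  have hN : ∀ (U : Matrix β β (MvPolynomial (σ × τ) K)) (a b : ℕ), p b * U * p a = U →
      VacSpan (p 0) (colSum e) U →
      ∃ w ∈ Algebra.adjoin (MvPolynomial (σ × τ) K) (Set.range (colSum e) ∪ Set.range d),
        U = p b * w * p a := by
    intro U a b hU hV
    obtain ⟨w, hw, hw'⟩ := h.exists_adjoin_of_vacSpan hs (p_mul_colSum h)
      (p_zero_mul_colSum h) hV a b
    exact ⟨w, hw, by rw [← hw', hU]⟩
  induction b with
  | zero =>
    intro a U hU _
    refine hN U a 0 hU (VacSpan.vac U ?_)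
    rw [← hU, ← mul_assoc, ← mul_assoc, h.p_mul_self]
  | succ b ih =>
    intro a U hU hm
    obtain ⟨V, hV⟩ := exists_sub_mul_genSum_mem h _ (genSum d * extC K σ τ β U)
      ((IsHomMat.genSum d).mul (IsHomMat.extC U)) hm
    rcases a with - | a
    · refine hN U 0 _ hU (vacSpan_of_genSum_mul_mem h Finset.univ U ?_)
      have := mul_mem_linMat_right hV (extC K σ τ β (p 0))
      rw [sub_mul, mul_assoc (extC K σ τ β V), genSum_mul_p_zero h, mul_zero, sub_zero,
        mul_assoc, ← map_mul] at this
      have e₁ : U * p 0 = U := by rw [← hU, mul_assoc, h.p_mul_self]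
      rwa [e₁] at this
    · have h₁ : genSum d * extC K σ τ β U - extC K σ τ β (p b * V * p a) * genSum d ∈
          linMat K σ β (Finset.univ : Finset τ) := by
        have := mul_mem_linMat_left (extC K σ τ β (p b))
          (mul_mem_linMat_right hV (extC K σ τ β (p (a + 1))))
        convert this using 1
        rw [sub_mul, mul_sub, mul_assoc (extC K σ τ β V), ← p_mul_genSum h a, ← mul_assoc,
          ← mul_assoc, p_mul_genSum h b]
        conv_lhs => rw [← hU]
        simp only [map_mul, mul_assoc]
      obtain ⟨w', hw', hVw⟩ := ih a (p b * V * p a)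
        (by
          rw [← mul_assoc, ← mul_assoc, h.p_mul_self, mul_assoc, h.p_mul_self])
        (by
          have := mul_mem_linMat_left (genSum d) h₁
          rw [mul_sub, ← mul_assoc, genSum_mul_self h, zero_mul, zero_sub, ← mul_assoc] at this
          exact (Submodule.neg_mem_iff _).1 this)
      obtain ⟨w, hw, hww⟩ := exists_adjoin_sub_mem h hw'
      have h₂ : genSum d * extC K σ τ β (p (b + 1) * w * p (a + 1)) -
          extC K σ τ β (p b * V * p a) * genSum d ∈
          linMat K σ β (Finset.univ : Finset τ) := by
        have := mul_mem_linMat_left (extC K σ τ β (p b))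
          (mul_mem_linMat_right hww (extC K σ τ β (p (a + 1))))
        convert this using 1
        rw [hVw, sub_mul, mul_sub, mul_assoc (extC K σ τ β w'), ← p_mul_genSum h a, map_mul,
          map_mul, map_mul, map_mul, ← mul_assoc, ← mul_assoc, ← p_mul_genSum h b]
        simp only [mul_assoc]
      have h₃ : genSum d * extC K σ τ β (U - p (b + 1) * w * p (a + 1)) ∈
          linMat K σ β (Finset.univ : Finset τ) := by
        convert Submodule.sub_mem _ h₁ h₂ using 1
        rw [map_sub, mul_sub]
        abel
      have h₄ := vacSpan_of_genSum_mul_mem h Finset.univ _ h₃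
      obtain ⟨w₃, hw₃, e₃⟩ := hN (U - p (b + 1) * w * p (a + 1)) (a + 1) (b + 1) (by
        rw [mul_sub, sub_mul, hU, ← mul_assoc, ← mul_assoc, h.p_mul_self, mul_assoc (_ * w),
          h.p_mul_self]) h₄
      exact ⟨w + w₃, Subalgebra.add_mem _ hw hw₃, by
        rw [mul_add, add_mul, ← e₃, add_sub_cancel]⟩

end Fock

end GenericMatrix

/-! ### Elimination over the function field -/

namespace GenericMatrix

open MvPolynomial Matrix

set_option linter.unusedSectionVars false

variable {K : Type} [Field K] {σ τ β : Type} [Fintype σ] [DecidableEq σ] [Fintype τ]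
  [DecidableEq τ] [Fintype β] [DecidableEq β]

/-- The substitution `elim`, solving all equations `lin univ j = 0`, applied to matrices. -/
def elimMat (K : Type) [Field K] {σ : Type} (τ β : Type) [Fintype σ] [DecidableEq σ] [Fintype τ]
    [DecidableEq τ] [Fintype β] [DecidableEq β] (k₀ : σ) :
    Matrix β β (BiPoly K σ τ) →+* Matrix β β (FractionRing (BiPoly K σ τ)) :=
  (elim K (Finset.univ.erase k₀) k₀ (Finset.univ : Finset τ)).mapMatrix

lemma mem_linMat_of_elimMat_eq_zero (k₀ : σ) {k : ℕ} {Y : Matrix β β (BiPoly K σ τ)}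
    (hY : IsHomMat (k + 1) Y) (h : elimMat K τ β k₀ Y = 0) :
    Y ∈ linMat K σ β (Finset.univ : Finset τ) := by
  intro i j
  have hi : insert k₀ (Finset.univ.erase k₀) = (Finset.univ : Finset σ) :=
    Finset.insert_erase (Finset.mem_univ k₀)
  have := mem_linIdeal_of_elim_eq_zero (isRegularForms _) (Finset.notMem_erase k₀ Finset.univ)
    (by rw [hi]; exact IsHomMat.mem_varIdeal (hY i j)) (congrFun (congrFun h i) j)
  rwa [hi] at this

lemma elimMat_smul (k₀ : σ) (f : BiPoly K σ τ) (Y : Matrix β β (BiPoly K σ τ)) :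
    elimMat K τ β k₀ (f • Y) =
      elim K (Finset.univ.erase k₀) k₀ (Finset.univ : Finset τ) f • elimMat K τ β k₀ Y := by
  ext1 i j
  exact map_mul (elim K (Finset.univ.erase k₀) k₀ (Finset.univ : Finset τ)) _ _

/-- The composite of `elimMat` with the scalar extension `extC`. -/
def elimExt (K : Type) [Field K] {σ : Type} (τ β : Type) [Fintype σ] [DecidableEq σ] [Fintype τ]
    [DecidableEq τ] [Fintype β] [DecidableEq β] (k₀ : σ) :
    Matrix β β (MvPolynomial (σ × τ) K) →+* Matrix β β (FractionRing (BiPoly K σ τ)) :=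
  (elimMat K τ β k₀).comp (extC K σ τ β)

lemma elimMat_genSum (k₀ : σ) (d : σ → Matrix β β (MvPolynomial (σ × τ) K)) :
    elimMat K τ β k₀ (genSum d) =
      ∑ i, algebraMap (BiPoly K σ τ) (FractionRing (BiPoly K σ τ)) (X i) •
        elimExt K τ β k₀ (d i) := by
  rw [genSum, map_sum]
  refine Finset.sum_congr rfl fun i _ => ?_
  rw [elimMat_smul, elim_X]
  rfl

lemma elimExt_colSum (k₀ : σ) (e : σ → Matrix β β (MvPolynomial (σ × τ) K)) (j : τ) :
    elimExt K τ β k₀ (colSum e j) =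
      ∑ i, algebraMap (BiPoly K σ τ) (FractionRing (BiPoly K σ τ)) (C (X (i, j))) •
        (elimExt K τ β k₀ (e i) -
          (algebraMap (BiPoly K σ τ) (FractionRing (BiPoly K σ τ)) (X i) /
            algebraMap (BiPoly K σ τ) (FractionRing (BiPoly K σ τ)) (X k₀)) •
            elimExt K τ β k₀ (e k₀)) := by
  have hy := algebraMap_X_ne_zero (K := K) (τ := τ) k₀
  have h₁ : elimExt K τ β k₀ (colSum e j) =
      ∑ i, elim K (Finset.univ.erase k₀) k₀ (Finset.univ : Finset τ) (C (X (i, j))) •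
        elimExt K τ β k₀ (e i) := by
    rw [colSum, map_sum]
    refine Finset.sum_congr rfl fun i _ => ?_
    rw [elimExt, RingHom.comp_apply, extC_smul, elimMat_smul]
    rfl
  rw [h₁, ← Finset.add_sum_erase _ _ (Finset.mem_univ k₀),
    ← Finset.add_sum_erase _ _ (Finset.mem_univ k₀), div_self hy, one_smul, sub_self, smul_zero,
    zero_add, elim_C_X, if_pos ⟨rfl, Finset.mem_univ j⟩, lin, map_sum, Finset.mul_sum,
    Finset.sum_smul, ← Finset.sum_add_distrib]
  refine Finset.sum_congr rfl fun i hi => ?_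
  have hne : ¬(i = k₀ ∧ j ∈ (Finset.univ : Finset τ)) := fun h => Finset.ne_of_mem_erase hi h.1
  rw [elim_C_X, if_neg hne, smul_sub, smul_smul, add_comm, sub_eq_add_neg, ← neg_smul, map_mul]
  congr 2
  field_simp

lemma det_X_ne_zero {ι : σ → τ} (hι : Function.Injective ι) :
    (Matrix.of fun q r => (X (q, ι r) : MvPolynomial (σ × τ) K)).det ≠ 0 := by
  intro h
  have := congrArg (eval fun ij : σ × τ => if ij.2 = ι ij.1 then (1 : K) else 0) h
  rw [RingHom.map_det, map_zero] at this
  have e : ((eval fun ij : σ × τ => if ij.2 = ι ij.1 then (1 : K) else 0).mapMatrix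
      (Matrix.of fun q r => (X (q, ι r) : MvPolynomial (σ × τ) K))) = 1 := by
    ext q r
    simp [Matrix.one_apply, hι.eq_iff, eq_comm]
  rw [e, det_one] at this
  exact one_ne_zero this

lemma mem_span_elimExt_colSum {ι : σ → τ} (hι : Function.Injective ι) (k₀ : σ)
    (e : σ → Matrix β β (MvPolynomial (σ × τ) K)) (q : σ) :
    elimExt K τ β k₀ (e q) -
      (algebraMap (BiPoly K σ τ) (FractionRing (BiPoly K σ τ)) (X q) /
        algebraMap (BiPoly K σ τ) (FractionRing (BiPoly K σ τ)) (X k₀)) •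
        elimExt K τ β k₀ (e k₀) ∈
      Submodule.span (FractionRing (BiPoly K σ τ))
        (Set.range fun j => elimExt K τ β k₀ (colSum e j)) := by
  set e' := fun q => elimExt K τ β k₀ (e q) -
      (algebraMap (BiPoly K σ τ) (FractionRing (BiPoly K σ τ)) (X q) /
        algebraMap (BiPoly K σ τ) (FractionRing (BiPoly K σ τ)) (X k₀)) •
        elimExt K τ β k₀ (e k₀) with he'
  set f : MvPolynomial (σ × τ) K →+* FractionRing (BiPoly K σ τ) :=
    (algebraMap (BiPoly K σ τ) (FractionRing (BiPoly K σ τ))).comp C with hf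
  set B := f.mapMatrix (Matrix.of fun q r => (X (q, ι r) : MvPolynomial (σ × τ) K)) with hB
  have hdet : IsUnit B.det := by
    rw [isUnit_iff_ne_zero, hB, ← RingHom.map_det]
    have hinj : Function.Injective f :=
      (IsFractionRing.injective (BiPoly K σ τ) _).comp (C_injective _ _)
    rw [Ne, map_eq_zero_iff f hinj]
    exact det_X_ne_zero hι
  have hsum : e' q = ∑ r, B⁻¹ r q • elimExt K τ β k₀ (colSum e (ι r)) := by
    simp only [elimExt_colSum, Finset.smul_sum, smul_smul]
    rw [Finset.sum_comm]
    have h₁ : ∀ s, ∑ r, (B⁻¹ r q * algebraMap (BiPoly K σ τ) (FractionRing (BiPoly K σ τ))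
        (C (X (s, ι r)))) • e' s = (1 : Matrix σ σ (FractionRing (BiPoly K σ τ))) s q • e' s := by
      intro s
      rw [← Matrix.mul_nonsing_inv B hdet, Matrix.mul_apply, Finset.sum_smul]
      refine Finset.sum_congr rfl fun r _ => ?_
      rw [mul_comm]
      rfl
    rw [Finset.sum_congr rfl fun s _ => h₁ s, Finset.sum_eq_single q]
    · rw [Matrix.one_apply_eq, one_smul]
    · intro s _ hs
      rw [Matrix.one_apply_ne hs, zero_smul]
    · simp
  change e' q ∈ _
  rw [hsum]
  exact Submodule.sum_mem _ fun r _ =>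
    Submodule.smul_mem _ _ (Submodule.subset_span ⟨ι r, rfl⟩)

variable {e d : σ → Matrix β β (MvPolynomial (σ × τ) K)}
  {p : ℕ → Matrix β β (MvPolynomial (σ × τ) K)}

lemma elimMat_genSum_mul_of_vacSpan (h : IsFock e d p) (k₀ : σ)
    {z : Matrix β β (MvPolynomial (σ × τ) K)} (hz : VacSpan (p 0) (colSum e) z) :
    elimMat K τ β k₀ (genSum d) * elimExt K τ β k₀ z = 0 := by
  induction hz with
  | vac r hr =>
    rw [← hr, elimExt, RingHom.comp_apply, map_mul, ← map_mul, ← mul_assoc, genSum_mul_p_zero h,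
      zero_mul, map_zero]
  | add r s _ _ hr hs => rw [map_add, mul_add, hr, hs, add_zero]
  | mul j r _ hr =>
    have h₁ := congrArg (elimMat K τ β k₀) (genSum_mul_colSum h j)
    have hl : elim K (Finset.univ.erase k₀) k₀ (Finset.univ : Finset τ)
        (lin K (Finset.univ : Finset σ) j) = 0 := by
      have := elim_lin (K := K) (Finset.notMem_erase k₀ Finset.univ) (Finset.mem_univ j)
      rwa [Finset.insert_erase (Finset.mem_univ k₀)] at this
    rw [map_add, map_mul, map_mul, elimMat_smul, hl, zero_smul] at h₁
    have h₂ := eq_neg_of_add_eq_zero_left h₁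
    rw [map_mul, ← mul_assoc]
    change (elimMat K τ β k₀ (genSum d) * elimMat K τ β k₀ (extC K σ τ β (colSum e j))) * _ = 0
    rw [h₂, Matrix.neg_mul, mul_assoc, hr, mul_zero, neg_zero]

lemma genSum_mul_mul_mem (h : IsFock e d p) (k₀ : σ) {ι : σ → τ} (hι : Function.Injective ι)
    {a : ℕ} {U : Matrix β β (MvPolynomial (σ × τ) K)} (hU : U * p a = U)
    (hV : ∀ L : List τ, L.length = a →
      VacSpan (p 0) (colSum e) (U * (L.map (colSum e)).prod * p 0)) :
    genSum d * extC K σ τ β U * genSum d ∈ linMat K σ β (Finset.univ : Finset τ) := by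
  refine mem_linMat_of_elimMat_eq_zero k₀ (k := 1)
    (((IsHomMat.genSum d).mul (IsHomMat.extC U)).mul (IsHomMat.genSum d)) ?_
  have h' := h.map (elimExt K τ β k₀)
  set D := elimMat K τ β k₀ (genSum d) with hD
  have hD2 : D * D = 0 := by rw [hD, ← map_mul, genSum_mul_self h, map_zero]
  have hvac : VacSpan (elimExt K τ β k₀ (p 0)) (fun j => elimExt K τ β k₀ (colSum e j)) D := by
    refine h'.vacSpan_of_mul_eq_zero _ (algebraMap_X_ne_zero k₀)
      (fun q _ => mem_span_elimExt_colSum hι k₀ e q) Finset.univ D ?_ (by simp)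
    rw [← elimMat_genSum]
    exact hD2
  have key : ∀ z, VacSpan (elimExt K τ β k₀ (p 0)) (fun j => elimExt K τ β k₀ (colSum e j)) z →
      ∀ (c : ℕ) (L : List τ), L.length + c = a →
        D * elimExt K τ β k₀ (U * (L.map (colSum e)).prod * p c) * z = 0 := by
    intro z hz
    induction hz with
    | vac r hr =>
      intro c L hL
      rcases Nat.eq_zero_or_pos c with rfl | hc
      · rw [elimMat_genSum_mul_of_vacSpan h k₀ (hV L hL), zero_mul]
      · rw [← hr, ← mul_assoc, mul_assoc D, ← map_mul, mul_assoc _ (p c),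
          h.p_mul_of_ne c 0 hc.ne', mul_zero, map_zero, mul_zero, zero_mul]
    | add r s _ _ hr hs =>
      intro c L hL
      rw [mul_add, hr c L hL, hs c L hL, add_zero]
    | mul j r _ hr =>
      intro c L hL
      rw [← mul_assoc, mul_assoc D, ← map_mul, mul_assoc _ (p c)]
      rcases c with - | c
      · rw [p_zero_mul_colSum h, mul_zero, map_zero, mul_zero, zero_mul]
      · have := hr c (L ++ [j]) (by simp; omega)
        rw [List.map_append, List.prod_append, List.map_singleton, List.prod_singleton] at this
        rw [p_mul_colSum h, ← mul_assoc, mul_assoc U]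
        exact this
  have := key D hvac a [] (by simp)
  rw [List.map_nil, List.prod_nil, mul_one, hU] at this
  rw [map_mul, map_mul]
  exact this

theorem exists_adjoin_of_vacSpan_mul (h : IsFock e d p)
    (hs : ∀ r, ∃ c : MvPolynomial (σ × τ) K, p 0 * r * p 0 = c • p 0)
    (k₀ : σ) {ι : σ → τ} (hι : Function.Injective ι)
    {a b : ℕ} {U : Matrix β β (MvPolynomial (σ × τ) K)} (hU : p b * U * p a = U)
    (hV : ∀ L : List τ, L.length = a →
      VacSpan (p 0) (colSum e) (U * (L.map (colSum e)).prod * p 0)) :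
    ∃ w ∈ Algebra.adjoin (MvPolynomial (σ × τ) K) (Set.range (colSum e) ∪ Set.range d),
      U = p b * w * p a :=
  exists_adjoin_of_genSum_mul_mul_mem h hs b a U hU (genSum_mul_mul_mem h k₀ hι
    (by rw [← hU, mul_assoc, h.p_mul_self]) hV)

end GenericMatrix

/-! ### The Fock representation on the exterior algebra -/

namespace ExteriorFock

open ExteriorAlgebra

variable (R : Type) [CommRing R] (m : ℕ)

/-- Exterior multiplication by the `i`-th basis vector. -/
def create (i : Fin m) : Module.End R (ExteriorAlgebra R (Fin m → R)) :=
  LinearMap.mulLeft R (ι R (Pi.single i 1))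

/-- Contraction with the `i`-th coordinate. -/
def annihilate (i : Fin m) : Module.End R (ExteriorAlgebra R (Fin m → R)) :=
  CliffordAlgebra.contractLeft (Q := (0 : QuadraticForm R (Fin m → R))) (LinearMap.proj i)

/-- The component of degree `a` of an element of the exterior algebra. -/
def compOf (a : ℕ) : ExteriorAlgebra R (Fin m → R) →ₗ[R] ⋀[R]^a (Fin m → R) :=
  (DirectSum.component R ℕ (fun i => ⋀[R]^i (Fin m → R)) a).comp
    (DirectSum.decomposeLinearEquiv fun i => ⋀[R]^i (Fin m → R)).toLinearMap

/-- The projection to the component of degree `a`. -/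
def projTo (a : ℕ) : Module.End R (ExteriorAlgebra R (Fin m → R)) :=
  (⋀[R]^a (Fin m → R)).subtype.comp (compOf R m a)

variable {R m}

lemma compOf_of_mem {a : ℕ} {x : ExteriorAlgebra R (Fin m → R)} (hx : x ∈ ⋀[R]^a (Fin m → R)) :
    compOf R m a x = ⟨x, hx⟩ :=
  Subtype.ext (DirectSum.decompose_of_mem_same (fun i => ⋀[R]^i (Fin m → R)) hx)

lemma compOf_of_mem_ne {a b : ℕ} (hab : a ≠ b) {x : ExteriorAlgebra R (Fin m → R)}
    (hx : x ∈ ⋀[R]^a (Fin m → R)) : compOf R m b x = 0 :=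
  Subtype.ext (DirectSum.decompose_of_mem_ne (fun i => ⋀[R]^i (Fin m → R)) hx hab)

lemma projTo_of_mem {a : ℕ} {x : ExteriorAlgebra R (Fin m → R)} (hx : x ∈ ⋀[R]^a (Fin m → R)) :
    projTo R m a x = x := by
  rw [projTo, LinearMap.comp_apply, compOf_of_mem hx]; rfl

lemma projTo_of_mem_ne {a b : ℕ} (hab : a ≠ b) {x : ExteriorAlgebra R (Fin m → R)}
    (hx : x ∈ ⋀[R]^a (Fin m → R)) : projTo R m b x = 0 := by
  rw [projTo, LinearMap.comp_apply, compOf_of_mem_ne hab hx]; rfl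

lemma projTo_mem (a : ℕ) (x : ExteriorAlgebra R (Fin m → R)) :
    projTo R m a x ∈ ⋀[R]^a (Fin m → R) := (compOf R m a x).2

lemma end_ext {f g : Module.End R (ExteriorAlgebra R (Fin m → R))}
    (h : ∀ a, ∀ x ∈ ⋀[R]^a (Fin m → R), f x = g x) : f = g := by
  refine LinearMap.ext fun x => ?_
  induction x using DirectSum.Decomposition.inductionOn (fun i => ⋀[R]^i (Fin m → R)) with
  | zero => simp
  | homogeneous x => exact h _ _ x.2
  | add x y hx hy => rw [map_add, map_add, hx, hy]

lemma mem_exteriorPower_zero {x : ExteriorAlgebra R (Fin m → R)}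
    (hx : x ∈ ⋀[R]^0 (Fin m → R)) : ∃ c, x = algebraMap R _ c := by
  have : x ∈ (1 : Submodule R (ExteriorAlgebra R (Fin m → R))) := by
    simpa [exteriorPower] using hx
  obtain ⟨c, hc⟩ := Submodule.mem_one.1 this
  exact ⟨c, hc.symm⟩

lemma one_mem_exteriorPower_zero :
    (1 : ExteriorAlgebra R (Fin m → R)) ∈ ⋀[R]^0 (Fin m → R) :=
  SetLike.GradedOne.one_mem (A := fun i => ⋀[R]^i (Fin m → R))

lemma ι_mul_mem {N : Type} [AddCommGroup N] [Module R N] {k : ℕ} (v : N)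
    {x : ExteriorAlgebra R N} (hx : x ∈ ⋀[R]^k N) : ι R v * x ∈ ⋀[R]^(k + 1) N := by
  rw [exteriorPower, pow_succ']
  exact Submodule.mul_mem_mul (LinearMap.mem_range_self _ v) hx

lemma create_mem (i : Fin m) {k : ℕ} {x : ExteriorAlgebra R (Fin m → R)}
    (hx : x ∈ ⋀[R]^k (Fin m → R)) : create R m i x ∈ ⋀[R]^(k + 1) (Fin m → R) :=
  ι_mul_mem _ hx

lemma annihilate_ι_mul (i : Fin m) (v : Fin m → R) (x : ExteriorAlgebra R (Fin m → R)) :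
    annihilate R m i (ι R v * x) = v i • x - ι R v * annihilate R m i x :=
  CliffordAlgebra.contractLeft_ι_mul (Q := (0 : QuadraticForm R (Fin m → R))) (LinearMap.proj i) v x

lemma annihilate_of_mem_zero (i : Fin m) {x : ExteriorAlgebra R (Fin m → R)}
    (hx : x ∈ ⋀[R]^0 (Fin m → R)) : annihilate R m i x = 0 := by
  obtain ⟨c, rfl⟩ := mem_exteriorPower_zero hx
  exact CliffordAlgebra.contractLeft_algebraMap (Q := (0 : QuadraticForm R (Fin m → R))) (LinearMap.proj i) c

lemma annihilate_mem (i : Fin m) (k : ℕ) : ∀ x ∈ ⋀[R]^(k + 1) (Fin m → R),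
    annihilate R m i x ∈ ⋀[R]^k (Fin m → R) := by
  induction k with
  | zero =>
    intro x hx
    rw [exteriorPower, zero_add, pow_one] at hx
    obtain ⟨v, rfl⟩ := hx
    have := annihilate_ι_mul i v 1
    rw [mul_one, annihilate_of_mem_zero i one_mem_exteriorPower_zero, mul_zero, sub_zero] at this
    rw [this]
    exact Submodule.smul_mem _ _ one_mem_exteriorPower_zero
  | succ k ih =>
    intro x hx
    rw [exteriorPower, pow_succ'] at hx
    induction hx using Submodule.mul_induction_on' with
    | mem_mul_mem v hv y hy =>
      obtain ⟨v, rfl⟩ := hv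
      rw [annihilate_ι_mul]
      exact Submodule.sub_mem _ (Submodule.smul_mem _ _ hy) (ι_mul_mem v (ih y hy))
    | add x _ y _ hx hy =>
      rw [map_add]
      exact Submodule.add_mem _ hx hy

lemma mulLeft_ι (v : Fin m → R) :
    LinearMap.mulLeft R (ι R v) = ∑ i, v i • create R m i := by
  have hv : v = ∑ i, v i • Pi.single i (1 : R) := by
    ext j; simp [Finset.sum_apply, Pi.single_apply]
  refine LinearMap.ext fun x => ?_
  rw [LinearMap.sum_apply]
  conv_lhs => rw [hv]
  simp only [LinearMap.mulLeft_apply, map_sum, map_smul, Finset.sum_mul, smul_mul_assoc,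
    LinearMap.smul_apply, create]

lemma prod_mul_create {l : List (Fin m)} (hl : l.Nodup) (k : Fin m) :
    (k ∈ l → (l.map fun i => annihilate R m i * create R m i).prod * create R m k = 0) ∧
    (k ∉ l → (l.map fun i => annihilate R m i * create R m i).prod * create R m k =
      create R m k * (l.map fun i => annihilate R m i * create R m i).prod) := by
  have hee : ∀ i, create R m i * create R m i = 0 := by
    intro i
    refine LinearMap.ext fun x => ?_
    simp [create, ← mul_assoc]
  have hne : ∀ i, i ≠ k → annihilate R m i * create R m i * create R m k =
      create R m k * (annihilate R m i * create R m i) := by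
    intro i hik
    refine LinearMap.ext fun x => ?_
    simp only [Module.End.mul_apply, create, LinearMap.mulLeft_apply, annihilate_ι_mul,
      Pi.single_eq_same, one_smul, Pi.single_eq_of_ne hik, zero_smul, zero_sub, mul_neg, mul_sub,
      sub_neg_eq_add]
    rw [sub_eq_add_neg]
    have : ι R (Pi.single i (1 : R)) * (ι R (Pi.single k (1 : R)) * annihilate R m i x) =
        -(ι R (Pi.single k (1 : R)) * (ι R (Pi.single i (1 : R)) * annihilate R m i x)) := by
      rw [← mul_assoc, ← mul_assoc, ← neg_mul]
      congr 1
      exact eq_neg_of_add_eq_zero_left (ι_add_mul_swap _ _)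
    rw [this]
  induction l with
  | nil => simp
  | cons i l ih =>
    rw [List.nodup_cons] at hl
    obtain ⟨ih₁, ih₂⟩ := ih hl.2
    rw [List.map_cons, List.prod_cons]
    constructor
    · intro hk
      rcases List.mem_cons.1 hk with rfl | hk
      · rw [mul_assoc, ih₂ hl.1, ← mul_assoc, mul_assoc (annihilate R m k), hee, mul_zero, zero_mul]
      · rw [mul_assoc, ih₁ hk, mul_zero]
    · intro hk
      rw [List.mem_cons, not_or] at hk
      rw [mul_assoc, ih₂ hk.2, ← mul_assoc, hne i (Ne.symm hk.1), mul_assoc]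

lemma isFock : IsFock (create R m) (annihilate R m) (projTo R m) where
  d_add i j := by
    refine LinearMap.ext fun x => ?_
    exact add_eq_zero_iff_eq_neg.2 (CliffordAlgebra.contractLeft_comm
      (Q := (0 : QuadraticForm R (Fin m → R))) (LinearMap.proj i) (LinearMap.proj j) x)
  d_sq i := by
    refine LinearMap.ext fun x => ?_
    exact CliffordAlgebra.contractLeft_contractLeft
      (Q := (0 : QuadraticForm R (Fin m → R))) (LinearMap.proj i) x
  d_e i := by
    refine LinearMap.ext fun x => ?_
    simp [create, annihilate_ι_mul]
  d_e_of_ne i j hij := by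
    refine LinearMap.ext fun x => ?_
    simp [create, annihilate_ι_mul, Pi.single_eq_of_ne hij]
  p_d a i := end_ext fun k x hx => by
    rw [Module.End.mul_apply, Module.End.mul_apply]
    rcases k with - | k
    · rw [annihilate_of_mem_zero i hx, projTo_of_mem_ne (Nat.succ_ne_zero a).symm hx, map_zero,
        map_zero]
    · have h := annihilate_mem i k x hx
      by_cases hka : k = a
      · subst hka
        rw [projTo_of_mem h, projTo_of_mem hx]
      · rw [projTo_of_mem_ne hka h, projTo_of_mem_ne (by omega) hx, map_zero]
  p_e a i := end_ext fun k x hx => by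
    rw [Module.End.mul_apply, Module.End.mul_apply]
    have h := create_mem i hx
    by_cases hka : k = a
    · subst hka
      rw [projTo_of_mem h, projTo_of_mem hx]
    · rw [projTo_of_mem_ne hka hx, projTo_of_mem_ne (by omega) h, map_zero]
  p_zero_e i := end_ext fun k x hx => by
    rw [Module.End.mul_apply, projTo_of_mem_ne (Nat.succ_ne_zero k) (create_mem i hx)]
    rfl
  d_p_zero i := by
    refine LinearMap.ext fun x => ?_
    exact annihilate_of_mem_zero i (projTo_mem 0 x)
  p_mul_self a := by
    refine LinearMap.ext fun x => ?_
    exact projTo_of_mem (projTo_mem a x)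
  p_mul_of_ne a b hab := by
    refine LinearMap.ext fun x => ?_
    exact projTo_of_mem_ne (Ne.symm hab) (projTo_mem b x)
  p_zero := by
    set P := (Finset.univ.toList.map fun i => annihilate R m i * create R m i).prod with hP
    have h₁ : P 1 = 1 := by
      rw [hP]
      generalize (Finset.univ : Finset (Fin m)).toList = l
      induction l with
      | nil => rfl
      | cons i l ih =>
        rw [List.map_cons, List.prod_cons, Module.End.mul_apply, ih, Module.End.mul_apply, create,
          LinearMap.mulLeft_apply, annihilate_ι_mul,
          annihilate_of_mem_zero i one_mem_exteriorPower_zero, Pi.single_eq_same]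
        simp
    have h₂ : ∀ k, P * create R m k = 0 := fun k =>
      (prod_mul_create (Finset.nodup_toList _) k).1 (Finset.mem_toList.2 (Finset.mem_univ k))
    refine LinearMap.ext fun x => ?_
    induction x using CliffordAlgebra.left_induction with
    | algebraMap c =>
      rw [Algebra.algebraMap_eq_smul_one, map_smul, map_smul, h₁,
        projTo_of_mem one_mem_exteriorPower_zero]
    | add x y hx hy => rw [map_add, map_add, hx, hy]
    | ι_mul x v _ =>
      change projTo R m 0 (LinearMap.mulLeft R (ι R v) x) = P (LinearMap.mulLeft R (ι R v) x)
      rw [mulLeft_ι, ← Module.End.mul_apply, ← Module.End.mul_apply, Finset.mul_sum,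
        Finset.mul_sum]
      congr 1
      refine Finset.sum_congr rfl fun k _ => ?_
      rw [mul_smul_comm, mul_smul_comm, h₂, smul_zero]
      have : projTo R m 0 * create R m k = 0 := end_ext fun j x hx => by
        rw [Module.End.mul_apply, projTo_of_mem_ne (Nat.succ_ne_zero j) (create_mem k hx)]
        rfl
      rw [this, smul_zero]

lemma exists_projTo_zero_mul_mul (r : Module.End R (ExteriorAlgebra R (Fin m → R))) :
    ∃ c : R, projTo R m 0 * r * projTo R m 0 = c • projTo R m 0 := by
  obtain ⟨c, hc⟩ := mem_exteriorPower_zero (projTo_mem 0 (r 1))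
  refine ⟨c, ?_⟩
  refine LinearMap.ext fun x => ?_
  obtain ⟨t, ht⟩ := mem_exteriorPower_zero (projTo_mem 0 x)
  rw [Module.End.mul_apply, Module.End.mul_apply, LinearMap.smul_apply, ht,
    Algebra.algebraMap_eq_smul_one, map_smul, map_smul, hc, Algebra.algebraMap_eq_smul_one,
    smul_comm]

end ExteriorFock

/-! ### The Clifford action on the exterior algebra -/

namespace ExteriorFock

open ExteriorAlgebra

section

variable (K : Type) [Field K] (m n : ℕ)

/-- Exterior multiplication by `φ(g_j)`. -/
def theta (j : Fin n) :
    Module.End (detS K m n) (ExteriorAlgebra (detS K m n) (Fin m → detS K m n)) :=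
  LinearMap.mulLeft (detS K m n) (ι (detS K m n) (genφ K m n (Pi.single j 1)))

/-- The operators on the exterior algebra spanned by words in the Clifford generators. -/
def cliffordAlg :
    Subalgebra (detS K m n)
      (Module.End (detS K m n) (ExteriorAlgebra (detS K m n) (Fin m → detS K m n))) :=
  Algebra.adjoin (detS K m n) (Set.range (theta K m n) ∪ Set.range (annihilate (detS K m n) m))

/-- Matrices of operators with respect to the standard basis of the exterior algebra. -/
def matEquiv :
    Module.End (detS K m n) (ExteriorAlgebra (detS K m n) (Fin m → detS K m n)) ≃ₐ[detS K m n]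
      Matrix (Finset (Fin m)) (Finset (Fin m)) (detS K m n) :=
  LinearMap.toMatrixAlgEquiv (Pi.basisFun (detS K m n) (Fin m)).ExteriorAlgebra

end

variable {K : Type} [Field K] {m n : ℕ}

lemma theta_eq_sum (j : Fin n) :
    theta K m n j = ∑ i, (MvPolynomial.X (i, j) : detS K m n) • create (detS K m n) m i := by
  rw [theta, mulLeft_ι]
  refine Finset.sum_congr rfl fun i _ => ?_
  rw [genφ, Matrix.toLin'_apply, Matrix.mulVec_single_one]
  rfl

lemma matEquiv_theta (j : Fin n) : matEquiv K m n (theta K m n j) =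
    GenericMatrix.colSum (fun i => matEquiv K m n (create (detS K m n) m i)) j := by
  rw [theta_eq_sum, map_sum, GenericMatrix.colSum]
  exact Finset.sum_congr rfl fun i _ => map_smul _ _ _

lemma mulLeft_ι_mem_span (g : Fin n → detS K m n) :
    LinearMap.mulLeft (detS K m n) (ι (detS K m n) (genφ K m n g)) ∈
      Submodule.span (detS K m n) (Set.range (theta K m n)) := by
  have hg : g = ∑ j, g j • Pi.single j (1 : detS K m n) := by
    ext i; simp [Finset.sum_apply, Pi.single_apply]
  have : LinearMap.mulLeft (detS K m n) (ι (detS K m n) (genφ K m n g)) =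
      ∑ j, g j • theta K m n j := by
    refine LinearMap.ext fun x => ?_
    rw [LinearMap.sum_apply]
    conv_lhs => rw [hg]
    simp only [LinearMap.mulLeft_apply, map_sum, map_smul, Finset.sum_mul, smul_mul_assoc,
      LinearMap.smul_apply, theta]
  rw [this]
  exact Submodule.sum_mem _ fun j _ =>
    Submodule.smul_mem _ _ (Submodule.subset_span (Set.mem_range_self j))

lemma vacSpan_mulLeft_map (y : ExteriorAlgebra (detS K m n) (Fin n → detS K m n)) :
    VacSpan (projTo (detS K m n) m 0) (theta K m n)
      (LinearMap.mulLeft (detS K m n) (ExteriorAlgebra.map (genφ K m n) y) *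
        projTo (detS K m n) m 0) := by
  induction y using CliffordAlgebra.left_induction with
  | algebraMap c =>
    refine VacSpan.vac _ ?_
    have : LinearMap.mulLeft (detS K m n) (ExteriorAlgebra.map (genφ K m n)
        (algebraMap (detS K m n) (ExteriorAlgebra (detS K m n) (Fin n → detS K m n)) c)) =
        c • (1 : Module.End (detS K m n)
          (ExteriorAlgebra (detS K m n) (Fin m → detS K m n))) := by
      refine LinearMap.ext fun x => ?_
      rw [AlgHom.commutes, LinearMap.mulLeft_apply, ← Algebra.smul_def]
      rfl
    erw [this]
    rw [smul_mul_assoc, one_mul, mul_smul_comm, (isFock (R := detS K m n)).p_mul_self]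
  | add x y hx hy =>
    have : LinearMap.mulLeft (detS K m n) (ExteriorAlgebra.map (genφ K m n) (x + y)) =
        LinearMap.mulLeft (detS K m n) (ExteriorAlgebra.map (genφ K m n) x) +
        LinearMap.mulLeft (detS K m n) (ExteriorAlgebra.map (genφ K m n) y) := by
      refine LinearMap.ext fun z => ?_
      simp [add_mul]
    rw [this, add_mul]
    exact VacSpan.add _ _ hx hy
  | ι_mul x v hx =>
    have : LinearMap.mulLeft (detS K m n) (ExteriorAlgebra.map (genφ K m n)
        (ι (detS K m n) v * x)) =
        LinearMap.mulLeft (detS K m n) (ι (detS K m n) (genφ K m n v)) *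
        LinearMap.mulLeft (detS K m n) (ExteriorAlgebra.map (genφ K m n) x) := by
      refine LinearMap.ext fun z => ?_
      rw [Module.End.mul_apply, LinearMap.mulLeft_apply, LinearMap.mulLeft_apply,
        LinearMap.mulLeft_apply, map_mul, ExteriorAlgebra.map_apply_ι, mul_assoc]
    erw [this]
    rw [mul_assoc]
    exact VacSpan.mul_of_mem_span (mulLeft_ι_mem_span v) hx

/-- A product of `a` operators `theta j` applied to the vacuum. -/
lemma prod_theta_one_mem (L : List (Fin n)) :
    ∃ y ∈ ⋀[detS K m n]^L.length (Fin n → detS K m n),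
      (L.map (theta K m n)).prod 1 = ExteriorAlgebra.map (genφ K m n) y := by
  induction L with
  | nil => exact ⟨1, one_mem_exteriorPower_zero, (map_one _).symm⟩
  | cons j L ih =>
    obtain ⟨y, hy, hy'⟩ := ih
    refine ⟨ι _ (Pi.single j 1) * y, ι_mul_mem _ hy, ?_⟩
    rw [List.map_cons, List.prod_cons, Module.End.mul_apply, hy', theta, LinearMap.mulLeft_apply,
      map_mul, ExteriorAlgebra.map_apply_ι]

lemma map_mem_exteriorPower {a : ℕ} : ∀ {y : ExteriorAlgebra (detS K m n) (Fin n → detS K m n)},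
    y ∈ ⋀[detS K m n]^a (Fin n → detS K m n) →
    ExteriorAlgebra.map (genφ K m n) y ∈ ⋀[detS K m n]^a (Fin m → detS K m n) := by
  intro y hy
  have := Submodule.mem_map_of_mem (f := (ExteriorAlgebra.map (genφ K m n)).toLinearMap) hy
  rw [exteriorPower, Submodule.map_pow] at this
  have hle : Submodule.map (ExteriorAlgebra.map (genφ K m n)).toLinearMap
      (LinearMap.range (ι (detS K m n))) ≤
      LinearMap.range (ι (detS K m n) (M := Fin m → detS K m n)) := by
    rintro _ ⟨_, ⟨v, rfl⟩, rfl⟩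
    exact ⟨genφ K m n v, (ExteriorAlgebra.map_apply_ι _ v).symm⟩
  exact pow_le_pow_left' hle a this

theorem exists_cliffordAlg_of_vacSpan (hm : 0 < m) (hmn : m ≤ n) {a b : ℕ}
    {U : Module.End (detS K m n) (ExteriorAlgebra (detS K m n) (Fin m → detS K m n))}
    (hU : projTo _ m b * U * projTo _ m a = U)
    (hV : ∀ L : List (Fin n), L.length = a →
      VacSpan (projTo _ m 0) (theta K m n) (U * (L.map (theta K m n)).prod * projTo _ m 0)) :
    ∃ w ∈ cliffordAlg K m n, U = projTo _ m b * w * projTo _ m a := by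
  have hF := (isFock (R := detS K m n) (m := m)).map (matEquiv K m n).toRingEquiv.toRingHom
  have hVmap : ∀ z, VacSpan (projTo _ m 0) (theta K m n) z →
      VacSpan (matEquiv K m n (projTo _ m 0))
        (GenericMatrix.colSum (fun i => matEquiv K m n (create (detS K m n) m i)))
        (matEquiv K m n z) := by
    intro z hz
    induction hz with
    | vac r hr => exact VacSpan.vac _ (by rw [← map_mul, hr])
    | add r s _ _ hr hs => rw [map_add]; exact VacSpan.add _ _ hr hs
    | mul j r _ hr => rw [map_mul, matEquiv_theta]; exact VacSpan.mul _ _ hr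
  obtain ⟨w, hw, hUw⟩ := GenericMatrix.exists_adjoin_of_vacSpan_mul (K := K) (τ := Fin n) hF
    (a := a) (b := b) (U := matEquiv K m n U)
    (fun r => by
      obtain ⟨c, hc⟩ := exists_projTo_zero_mul_mul ((matEquiv K m n).symm r)
      refine ⟨c, ?_⟩
      have := congrArg (matEquiv K m n) hc
      rw [map_mul, map_mul, AlgEquiv.apply_symm_apply, map_smul] at this
      exact this)
    ⟨0, hm⟩ (Fin.castLE_injective hmn)
    (by
      have := congrArg (matEquiv K m n) hU
      rw [map_mul, map_mul] at this
      exact this)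
    (fun L hL => by
      have := hVmap _ (hV L hL)
      rw [map_mul, map_mul, map_list_prod, List.map_map] at this
      have hc : (matEquiv K m n ∘ theta K m n) =
          GenericMatrix.colSum (fun i => matEquiv K m n (create (detS K m n) m i)) :=
        funext matEquiv_theta
      rw [hc] at this
      exact this)
  refine ⟨(matEquiv K m n).symm w, ?_, ?_⟩
  · have : (matEquiv K m n).symm.toAlgHom w ∈ (Algebra.adjoin (detS K m n)
        (Set.range (GenericMatrix.colSum (fun i => matEquiv K m n (create (detS K m n) m i))) ∪
          Set.range fun i => matEquiv K m n (annihilate (detS K m n) m i))).map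
        (matEquiv K m n).symm.toAlgHom := ⟨w, hw, rfl⟩
    rw [AlgHom.map_adjoin] at this
    refine Algebra.adjoin_mono ?_ this
    rintro _ ⟨_, ⟨j, rfl⟩ | ⟨i, rfl⟩, rfl⟩
    · refine Or.inl ⟨j, ?_⟩
      rw [← matEquiv_theta]
      exact ((matEquiv K m n).symm_apply_apply _).symm
    · exact Or.inr ⟨i, ((matEquiv K m n).symm_apply_apply _).symm⟩
  · apply (matEquiv K m n).injective
    rw [map_mul, map_mul, AlgEquiv.apply_symm_apply]
    exact hUw

lemma detπa_eq_zero_iff {a : ℕ} {x : ⋀[detS K m n]^a (Fin m → detS K m n)} :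
    detπa K m n a x = 0 ↔ ∃ y ∈ ⋀[detS K m n]^a (Fin n → detS K m n),
      ExteriorAlgebra.map (genφ K m n) y = x :=
  Submodule.Quotient.mk_eq_zero _

/-- Every homomorphism `M_a → M_b` is induced by an element of the Clifford algebra. -/
theorem exists_cliffordAlg_lift (hm : 0 < m) (hmn : m ≤ n) {a b : ℕ}
    (f : detMa K m n a →ₗ[detS K m n] detMa K m n b) :
    ∃ w ∈ cliffordAlg K m n, ∀ x : ⋀[detS K m n]^a (Fin m → detS K m n),
      f (detπa K m n a x) = detπa K m n b (compOf _ m b (w x)) := by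
  have hproj : Module.Projective (detS K m n)
      (ExteriorAlgebra (detS K m n) (Fin m → detS K m n)) :=
    Module.Projective.of_basis (Pi.basisFun (detS K m n) (Fin m)).ExteriorAlgebra
  obtain ⟨g, hg⟩ := Module.projective_lifting_property (detπa K m n b)
    ((f.comp (detπa K m n a)).comp (compOf _ m a)) (Submodule.mkQ_surjective _)
  have hg' : ∀ x (hx : x ∈ ⋀[detS K m n]^a (Fin m → detS K m n)),
      detπa K m n b (g x) = f (detπa K m n a ⟨x, hx⟩) := fun x hx => by
    have := LinearMap.congr_fun hg x
    rw [LinearMap.comp_apply, LinearMap.comp_apply, compOf_of_mem hx] at this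
    exact this
  set U : Module.End (detS K m n) (ExteriorAlgebra (detS K m n) (Fin m → detS K m n)) :=
    ((⋀[detS K m n]^b (Fin m → detS K m n)).subtype.comp g) * projTo _ m a with hUdef
  have hUmem : ∀ x (hx : x ∈ ⋀[detS K m n]^a (Fin m → detS K m n)), U x = g x := fun x hx => by
    rw [hUdef, Module.End.mul_apply, projTo_of_mem hx]
    rfl
  have hU : projTo _ m b * U * projTo _ m a = U := by
    refine LinearMap.ext fun x => ?_
    rw [Module.End.mul_apply, Module.End.mul_apply, hUmem _ (projTo_mem a x),
      projTo_of_mem (g _).2]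
    rfl
  clear_value U
  obtain ⟨w, hw, hUw⟩ := exists_cliffordAlg_of_vacSpan hm hmn hU (by
    intro L hL
    obtain ⟨y, hy, hy'⟩ := prod_theta_one_mem (K := K) (m := m) L
    rw [hL] at hy
    have hmem := map_mem_exteriorPower (m := m) hy
    have h0 := hg' _ hmem
    rw [(detπa_eq_zero_iff (x := ⟨_, hmem⟩)).2 ⟨y, hy, rfl⟩, map_zero, detπa_eq_zero_iff] at h0
    obtain ⟨z, -, hz⟩ := h0
    have : U * (L.map (theta K m n)).prod * projTo _ m 0 =
        LinearMap.mulLeft (detS K m n) (ExteriorAlgebra.map (genφ K m n) z) *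
          projTo _ m 0 := by
      refine LinearMap.ext fun x => ?_
      obtain ⟨c, hc⟩ := mem_exteriorPower_zero (projTo_mem 0 x)
      rw [Module.End.mul_apply, Module.End.mul_apply, Module.End.mul_apply, hc,
        Algebra.algebraMap_eq_smul_one, map_smul, map_smul, map_smul, hy', hUmem _ hmem, ← hz,
        LinearMap.mulLeft_apply, mul_one]
    rw [this]
    exact vacSpan_mulLeft_map z)
  refine ⟨w, hw, fun x => ?_⟩
  have h := LinearMap.congr_fun hUw (x : ExteriorAlgebra (detS K m n) (Fin m → detS K m n))
  rw [hUmem _ x.2, Module.End.mul_apply, Module.End.mul_apply, projTo_of_mem x.2] at h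
  rw [← hg' x.1 x.2]
  exact congrArg _ (Subtype.ext h)

variable {D : Module.Dual (detS K m n) (Fin m → detS K m n) →
      ∀ c : ℕ, detMa K m n (c + 1) →ₗ[detS K m n] detMa K m n c}
    {T : (Fin n → detS K m n) → ∀ c : ℕ, detMa K m n c →ₗ[detS K m n] detMa K m n (c + 1)}

/-- A monomial in the Clifford generators acts on `⋀^a` as zero or induces a word. -/
lemma eq_zero_or_isWord_of_mem_closure
    (hD : ∀ lam (c : ℕ) (x : ⋀[detS K m n]^(c+1) (Fin m → detS K m n))
      (y : ⋀[detS K m n]^c (Fin m → detS K m n)),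
      (y : ExteriorAlgebra (detS K m n) (Fin m → detS K m n)) = ctr K m n lam x →
      D lam c (detπa K m n (c+1) x) = detπa K m n c y)
    (hT : ∀ (g : Fin n → detS K m n) (c : ℕ)
      (x : ⋀[detS K m n]^c (Fin m → detS K m n))
      (y : ⋀[detS K m n]^(c+1) (Fin m → detS K m n)),
      (y : ExteriorAlgebra (detS K m n) (Fin m → detS K m n)) =
        ι (detS K m n) (genφ K m n g) * x → T g c (detπa K m n c x) = detπa K m n (c+1) y)
    (a : ℕ) {w : Module.End (detS K m n) (ExteriorAlgebra (detS K m n) (Fin m → detS K m n))}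
    (hw : w ∈ Submonoid.closure
      (Set.range (theta K m n) ∪ Set.range (annihilate (detS K m n) m))) :
    (∀ x ∈ ⋀[detS K m n]^a (Fin m → detS K m n), w x = 0) ∨
    ∃ c F, IsWord K m n D T a c F ∧ ∀ x : ⋀[detS K m n]^a (Fin m → detS K m n),
      ∃ h : w x ∈ ⋀[detS K m n]^c (Fin m → detS K m n),
        detπa K m n c ⟨w x, h⟩ = F (detπa K m n a x) := by
  induction hw using Submonoid.closure_induction_left with
  | one => exact Or.inr ⟨a, _, IsWord.id a, fun x => ⟨x.2, rfl⟩⟩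
  | mul_left s hs w _ ih =>
    rcases ih with ih | ⟨c, F, hF, ih⟩
    · exact Or.inl fun x hx => by rw [Module.End.mul_apply, ih x hx, map_zero]
    · rcases hs with ⟨j, rfl⟩ | ⟨i, rfl⟩
      · refine Or.inr ⟨c + 1, _, IsWord.up (Pi.single j 1) F hF, fun x => ?_⟩
        obtain ⟨h, h'⟩ := ih x
        refine ⟨ι_mul_mem _ h, ?_⟩
        rw [LinearMap.comp_apply, ← h']
        exact (hT _ _ _ _ rfl).symm
      · rcases c with - | c
        · refine Or.inl fun x hx => ?_
          obtain ⟨h, -⟩ := ih ⟨x, hx⟩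
          exact annihilate_of_mem_zero i h
        · refine Or.inr ⟨c, _, IsWord.down (LinearMap.proj i) F hF, fun x => ?_⟩
          obtain ⟨h, h'⟩ := ih x
          refine ⟨annihilate_mem i c _ h, ?_⟩
          rw [LinearMap.comp_apply, ← h']
          exact (hD _ _ _ _ rfl).symm

/-- An element of the Clifford algebra induces a combination of words. -/
lemma exists_mem_span_isWord
    (hD : ∀ lam (c : ℕ) (x : ⋀[detS K m n]^(c+1) (Fin m → detS K m n))
      (y : ⋀[detS K m n]^c (Fin m → detS K m n)),
      (y : ExteriorAlgebra (detS K m n) (Fin m → detS K m n)) = ctr K m n lam x →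
      D lam c (detπa K m n (c+1) x) = detπa K m n c y)
    (hT : ∀ (g : Fin n → detS K m n) (c : ℕ)
      (x : ⋀[detS K m n]^c (Fin m → detS K m n))
      (y : ⋀[detS K m n]^(c+1) (Fin m → detS K m n)),
      (y : ExteriorAlgebra (detS K m n) (Fin m → detS K m n)) =
        ι (detS K m n) (genφ K m n g) * x → T g c (detπa K m n c x) = detπa K m n (c+1) y)
    (a b : ℕ) {w : Module.End (detS K m n) (ExteriorAlgebra (detS K m n) (Fin m → detS K m n))}
    (hw : w ∈ cliffordAlg K m n) :
    ∃ F ∈ Submodule.span (detS K m n) {F | IsWord K m n D T a b F},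
      ∀ x : ⋀[detS K m n]^a (Fin m → detS K m n),
        detπa K m n b (compOf _ m b (w x)) = F (detπa K m n a x) := by
  rw [cliffordAlg, ← Subalgebra.mem_toSubmodule, Algebra.adjoin_eq_span] at hw
  induction hw using Submodule.span_induction with
  | mem w hw =>
    rcases eq_zero_or_isWord_of_mem_closure hD hT a hw with h | ⟨c, F, hF, h⟩
    · exact ⟨0, Submodule.zero_mem _, fun x => by
        rw [h x x.2, map_zero, map_zero, LinearMap.zero_apply]⟩
    · by_cases hcb : c = b
      · subst hcb
        refine ⟨F, Submodule.subset_span hF, fun x => ?_⟩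
        obtain ⟨h, h'⟩ := h x
        rw [compOf_of_mem h, h']
      · refine ⟨0, Submodule.zero_mem _, fun x => ?_⟩
        obtain ⟨h, -⟩ := h x
        rw [compOf_of_mem_ne hcb h, map_zero, LinearMap.zero_apply]
  | zero => exact ⟨0, Submodule.zero_mem _, fun x => by simp⟩
  | add w w' _ _ ih ih' =>
    obtain ⟨F, hF, h⟩ := ih
    obtain ⟨F', hF', h'⟩ := ih'
    refine ⟨F + F', Submodule.add_mem _ hF hF', fun x => ?_⟩
    rw [LinearMap.add_apply, (compOf (detS K m n) m b).map_add, (detπa K m n b).map_add]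
    exact congrArg₂ (· + ·) (h x) (h' x)
  | smul c w _ ih =>
    obtain ⟨F, hF, h⟩ := ih
    refine ⟨c • F, Submodule.smul_mem _ c hF, fun x => ?_⟩
    change detπa K m n b (compOf _ m b (c • w x)) = c • F (detπa K m n a x)
    have e₁ := (compOf (detS K m n) m b).map_smul c (w x)
    have e₂ := (detπa K m n b).map_smul c (compOf (detS K m n) m b (w x))
    rw [e₁, e₂]
    exact congrArg (fun y : detMa K m n b => c • y) (h x)

end ExteriorFock

theorem hom_spanned_by_clifford_words (K : Type) [Field K] (m n : ℕ)
    (hm : 0 < m) (hmn : m ≤ n)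
    (D : Module.Dual (detS K m n) (Fin m → detS K m n) →
      ∀ c : ℕ, detMa K m n (c + 1) →ₗ[detS K m n] detMa K m n c)
    (T : (Fin n → detS K m n) →
      ∀ c : ℕ, detMa K m n c →ₗ[detS K m n] detMa K m n (c + 1))
    -- `D λ c` is the operator induced on the cokernels by left contraction with `λ`:
    (hD : ∀ lam (c : ℕ) (x : ⋀[detS K m n]^(c+1) (Fin m → detS K m n))
      (y : ⋀[detS K m n]^c (Fin m → detS K m n)),
      (y : ExteriorAlgebra (detS K m n) (Fin m → detS K m n)) = ctr K m n lam x →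
      D lam c (detπa K m n (c+1) x) = detπa K m n c y)
    -- `T g c` is the operator induced on the cokernels by left multiplication with `φ(g)`:
    (hT : ∀ (g : Fin n → detS K m n) (c : ℕ)
      (x : ⋀[detS K m n]^c (Fin m → detS K m n))
      (y : ⋀[detS K m n]^(c+1) (Fin m → detS K m n)),
      (y : ExteriorAlgebra (detS K m n) (Fin m → detS K m n)) =
        ExteriorAlgebra.ι (detS K m n) (genφ K m n g) * (x : ExteriorAlgebra (detS K m n) (Fin m → detS K m n)) →
      T g c (detπa K m n c x) = detπa K m n (c+1) y) :
    ∀ a b : ℕ, 1 ≤ a → a ≤ m → 1 ≤ b → b ≤ m →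
      ∀ f : detMa K m n a →ₗ[detS K m n] detMa K m n b,
        f ∈ Submodule.span (detS K m n) {w | IsWord K m n D T a b w} := by
  intro a b _ _ _ _ f
  obtain ⟨w, hw, hfw⟩ := ExteriorFock.exists_cliffordAlg_lift hm hmn f
  obtain ⟨F, hF, hFw⟩ := ExteriorFock.exists_mem_span_isWord hD hT a b hw
  have : f = F := by
    refine LinearMap.ext fun y => ?_
    obtain ⟨x, rfl⟩ := Submodule.mkQ_surjective _ y
    exact (hfw x).trans (hFw x)
  rw [this]
  exact hF

end
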